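/- arXiv:1303.4313 — 3 statements merged into one kernel-verified Lean document; each statement's English description precedes it below -/
import Mathlib

section
/- Let U ⊆ (𝔽_q)^n be a subspace of dimension j and W ⊆ (𝔽_q)^n a subspace with dim(U + W) = k. Let l and m be integers with j ≤ l ≤ n and max(k, l) ≤ m ≤ min(n, k + l − j). Then the number of subspaces U⁺ of (𝔽_q)^n with dim U⁺ = l, U ⊆ U⁺, and dim(U⁺ + W) = m equals N · ℙ[m], where N is the total number of l-dimensional subspaces of (𝔽_q)^n containing U, and ℙ[m] = q^{(k+l−j−m)(m−n)} · (q⁻¹)_{n−k} (q⁻¹)_{n−l} (q⁻¹)_{k−j} (q⁻¹)_{l−j} / ( (q⁻¹)_{k+l−j−m} (q⁻¹)_{n−m} (q⁻¹)_{n−j} (q⁻¹)_{m−k} (q⁻¹)_{m−l} ). In other words, if U⁺ is chosen uniformly at random among the l-dimensional subspaces containing U, then dim(U⁺ + W) = m with probability ℙ[m]. -/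
/-- The Pochhammer symbol `(q⁻¹)_m = ∏_{i=1}^m (1 - q^{-i})`. -/
noncomputable def qPoch (q : ℚ) (m : ℕ) : ℚ :=
  ∏ i ∈ Finset.range m, (1 - q⁻¹ ^ (i + 1))


/-- A surjective linear map `f` splits the families with independent image as families in the
kernel times independent families in the target. -/
theorem card_linearIndependent_comp_of_surjective {F E R : Type*} [Field F]
    [AddCommGroup E] [Module F E] [AddCommGroup R] [Module F R]
    (f : E →ₗ[F] R) (hf : Function.Surjective f) (r : ℕ) :
    Nat.card {s : Fin r → E // LinearIndependent F (f ∘ s)} =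
      Nat.card (LinearMap.ker f) ^ r * Nat.card {t : Fin r → R // LinearIndependent F t} := by
  obtain ⟨g, hg⟩ := f.exists_rightInverse_of_surjective (LinearMap.range_eq_top.2 hf)
  have hfg : ∀ x, f (g x) = x := fun x => LinearMap.congr_fun hg x
  have e : {s : Fin r → E // LinearIndependent F (f ∘ s)} ≃
      (Fin r → LinearMap.ker f) × {t : Fin r → R // LinearIndependent F t} :=
    { toFun := fun s => (fun i => ⟨s.1 i - g (f (s.1 i)), by simp [hfg]⟩, ⟨f ∘ s.1, s.2⟩)
      invFun := fun p => ⟨fun i => (p.1 i : E) + g (p.2.1 i), by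
        convert p.2.2 using 1
        ext i
        simp [hfg]⟩
      left_inv := fun s => by ext i; simp
      right_inv := fun p => by
        ext i
        · simp [hfg]
        · simp [hfg] }
  rw [Nat.card_congr e, Nat.card_prod, Nat.card_fun, Nat.card_fin]

theorem qPoch_ne_zero {q : ℚ} (hq : 1 < q) (m : ℕ) : qPoch q m ≠ 0 := by
  refine Finset.prod_ne_zero_iff.2 fun i _ => ?_
  have := pow_lt_one₀ (inv_nonneg.2 (zero_le_one.trans hq.le)) (inv_lt_one_of_one_lt₀ hq)
    i.succ_ne_zero
  exact (sub_pos.2 this).ne'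

theorem prod_pow_sub_pow_mul_qPoch {q : ℚ} (hq : q ≠ 0) {r c : ℕ} (h : r ≤ c) :
    (∏ i ∈ Finset.range r, (q ^ c - q ^ i)) * qPoch q (c - r) = q ^ (c * r) * qPoch q c := by
  induction r with
  | zero => simp
  | succ r ih =>
    have hP : qPoch q (c - r) = qPoch q (c - (r + 1)) * (1 - q⁻¹ ^ (c - r)) := by
      obtain ⟨d, rfl⟩ := Nat.exists_eq_add_of_le h
      rw [show r + 1 + d - r = d + 1 by omega, Nat.add_sub_cancel_left, qPoch,
        Finset.prod_range_succ, qPoch]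
    have hc : q ^ c - q ^ r = q ^ c * (1 - q⁻¹ ^ (c - r)) := by
      obtain ⟨d, rfl⟩ := Nat.exists_eq_add_of_le (Nat.le_of_succ_le h)
      rw [Nat.add_sub_cancel_left, inv_pow, pow_add]
      field_simp
    rw [Finset.prod_range_succ, hc, mul_add_one, pow_add, mul_right_comm (q ^ (c * r)),
      ← ih (Nat.le_of_succ_le h), hP]
    ring

section Tuples

variable {F V : Type*} [Field F] [AddCommGroup V] [Module F V]

open Classical in
/-- The `r`-tuples in `B` that are linearly independent modulo `A`. -/
noncomputable def indepTuples [Finite V] (A B : Submodule F V) (r : ℕ) : Finset (Fin r → V) :=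
  (Set.toFinite {s | (∀ i, s i ∈ B) ∧ LinearIndependent F (A.mkQ ∘ s)}).toFinset

theorem mem_indepTuples [Finite V] {A B : Submodule F V} {r : ℕ} {s : Fin r → V} :
    s ∈ indepTuples A B r ↔ (∀ i, s i ∈ B) ∧ LinearIndependent F (A.mkQ ∘ s) := by
  simp [indepTuples]

theorem card_indepTuples [Fintype F] [Finite V] (A B : Submodule F V) {r c : ℕ}
    (hc : c + Module.finrank F ↥(A ⊓ B) = Module.finrank F B) (hr : r ≤ c) :
    ((indepTuples A B r).card : ℚ) * qPoch (Fintype.card F) (c - r) =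
      (Fintype.card F : ℚ) ^ (Module.finrank F B * r) * qPoch (Fintype.card F) c := by
  let f := (A.mkQ ∘ₗ B.subtype).rangeRestrict
  have hker : Module.finrank F (LinearMap.ker f) = Module.finrank F ↥(A ⊓ B) := by
    rw [LinearMap.ker_rangeRestrict, LinearMap.ker_comp, Submodule.ker_mkQ, inf_comm,
      ← Submodule.map_comap_subtype]
    exact (LinearEquiv.finrank_eq (Submodule.equivMapOfInjective _ B.injective_subtype _))
  have hrange := LinearMap.finrank_range_add_finrank_ker f
  rw [LinearMap.range_rangeRestrict, finrank_top, hker, ← hc, Nat.add_right_cancel_iff] at hrange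
  have e : indepTuples A B r ≃ {s : Fin r → B // LinearIndependent F (f ∘ s)} :=
    { toFun := fun s => ⟨fun i => ⟨s.1 i, (mem_indepTuples.1 s.2).1 i⟩,
        LinearIndependent.of_comp (Submodule.subtype _) (mem_indepTuples.1 s.2).2⟩
      invFun := fun s => ⟨fun i => s.1 i, mem_indepTuples.2 ⟨fun i => (s.1 i).2,
        s.2.map' (Submodule.subtype _) (Submodule.ker_subtype _)⟩⟩
      left_inv := fun s => rfl
      right_inv := fun s => rfl }
  have hcard : (indepTuples A B r).card =
      Nat.card {s : Fin r → B // LinearIndependent F (f ∘ s)} := by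
    rw [← Nat.card_congr e, Nat.card_eq_fintype_card, Fintype.card_coe]
  have : Finite (LinearMap.range (A.mkQ ∘ₗ B.subtype)) :=
    Finite.of_surjective f (LinearMap.surjective_rangeRestrict _)
  rw [hcard, card_linearIndependent_comp_of_surjective f (LinearMap.surjective_rangeRestrict _),
    card_linearIndependent (hrange.symm ▸ hr), hrange, Module.natCard_eq_pow_finrank (K := F), hker,
    Fin.prod_univ_eq_prod_range (fun i => Fintype.card F ^ c - Fintype.card F ^ i), Nat.cast_mul,
    Nat.cast_prod, mul_assoc, Nat.card_eq_fintype_card]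
  have hq0 : 0 < Fintype.card F := Fintype.card_pos
  rw [Finset.prod_congr rfl fun i hi => by
      rw [Nat.cast_sub (Nat.pow_le_pow_right hq0 ((Finset.mem_range.1 hi).le.trans hr))],
    ← hc]
  push_cast
  rw [prod_pow_sub_pow_mul_qPoch (by exact_mod_cast hq0.ne') hr]
  ring

theorem finrank_sup_span_range [Finite V] {A B : Submodule F V} {r : ℕ} {s : Fin r → V}
    (hs : s ∈ indepTuples A B r) :
    Module.finrank F ↥(A ⊔ Submodule.span F (Set.range s)) = Module.finrank F A + r := by
  have h := (mem_indepTuples.1 hs).2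
  have hd : Disjoint (Submodule.span F (Set.range s)) (LinearMap.ker A.mkQ) :=
    Submodule.range_ker_disjoint h
  rw [Submodule.ker_mkQ] at hd
  have := Submodule.finrank_sup_add_finrank_inf_eq A (Submodule.span F (Set.range s))
  rw [hd.symm.eq_bot, finrank_bot, add_zero,
    finrank_span_eq_card (LinearIndependent.of_comp _ h), Fintype.card_fin] at this
  exact this

theorem indepTuples_anti [Finite V] {A A' B : Submodule F V} (h : A ≤ A') {r : ℕ}
    {s : Fin r → V} (hs : s ∈ indepTuples A' B r) : s ∈ indepTuples A B r := by
  rw [mem_indepTuples] at hs ⊢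
  refine ⟨hs.1, LinearIndependent.of_comp (Submodule.mapQ A A' LinearMap.id h) ?_⟩
  exact hs.2

end Tuples

open Module Submodule in
/-- Ordered bases adapted to `U ≤ U' ⊓ (U ⊔ W) ≤ U'` count the subspaces `U'`. -/
theorem card_subspaces_mul {F V : Type*} [Field F] [Fintype F] [AddCommGroup V] [Module F V]
    [Finite V] (U W : Submodule F V) {k d e : ℕ} (hk : finrank F ↥(U ⊔ W) = k) :
    Nat.card {U' : Submodule F V // finrank F U' = finrank F U + d + e ∧ U ≤ U' ∧
        finrank F ↥(U' ⊔ W) = k + e} *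
      ((Fintype.card F : ℚ) ^ ((finrank F U + d) * d + (finrank F U + d + e) * e) *
        (qPoch (Fintype.card F) d * qPoch (Fintype.card F) e)) =
      ((indepTuples U (U ⊔ W) d).card : ℚ) * (indepTuples (U ⊔ W) ⊤ e).card := by
  classical
  let φ : (Fin d → V) × (Fin e → V) → Submodule F V :=
    fun p => U ⊔ span F (Set.range p.1) ⊔ span F (Set.range p.2)
  let T : Finset (Submodule F V) := (Set.toFinite {U' : Submodule F V |
    finrank F U' = finrank F U + d + e ∧ U ≤ U' ∧ finrank F ↥(U' ⊔ W) = k + e}).toFinset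
  have hT : ∀ U', U' ∈ T ↔ finrank F U' = finrank F U + d + e ∧ U ≤ U' ∧
      finrank F ↥(U' ⊔ W) = k + e := fun U' => by simp [T]
  have hrank : ∀ p ∈ indepTuples U (U ⊔ W) d ×ˢ indepTuples (U ⊔ W) ⊤ e,
      finrank F (φ p) = finrank F U + d + e ∧ finrank F ↥(φ p ⊔ W) = k + e := by
    intro p hp
    obtain ⟨hx, hy⟩ := Finset.mem_product.1 hp
    have hle : span F (Set.range p.1) ≤ U ⊔ W :=
      span_le.2 (Set.range_subset_iff.2 (mem_indepTuples.1 hx).1)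
    constructor
    · rw [finrank_sup_span_range (indepTuples_anti (sup_le le_sup_left hle) hy),
        finrank_sup_span_range hx]
    · have : φ p ⊔ W = U ⊔ W ⊔ span F (Set.range p.2) := by
        rw [sup_right_comm, sup_right_comm U, sup_eq_left.2 hle]
      rw [this, finrank_sup_span_range hy, hk]
  have hfib : ∀ U' ∈ T, {p ∈ indepTuples U (U ⊔ W) d ×ˢ indepTuples (U ⊔ W) ⊤ e | φ p = U'} =
      indepTuples U (U' ⊓ (U ⊔ W)) d ×ˢ indepTuples (U ⊔ W) U' e := by
    intro U' hU'
    obtain ⟨h1, h2, h3⟩ := (hT U').1 hU'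
    ext p
    rw [Finset.mem_filter]
    constructor
    · rintro ⟨hp, rfl⟩
      simp only [Finset.mem_product, mem_indepTuples] at hp ⊢
      refine ⟨⟨fun i => ⟨?_, hp.1.1 i⟩, hp.1.2⟩, ⟨fun i => ?_, hp.2.2⟩⟩
      · exact le_sup_left (a := U ⊔ _) (le_sup_right (a := U) (subset_span ⟨i, rfl⟩))
      · exact le_sup_right (a := U ⊔ _) (subset_span ⟨i, rfl⟩)
    · intro hp
      have hp' : p ∈ indepTuples U (U ⊔ W) d ×ˢ indepTuples (U ⊔ W) ⊤ e := by
        simp only [Finset.mem_product, mem_indepTuples] at hp ⊢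
        exact ⟨⟨fun i => (hp.1.1 i).2, hp.1.2⟩, ⟨fun i => mem_top, hp.2.2⟩⟩
      refine ⟨hp', eq_of_le_of_finrank_eq ?_ ((hrank p hp').1.trans h1.symm)⟩
      simp only [Finset.mem_product, mem_indepTuples] at hp
      exact sup_le (sup_le h2 (span_le.2 (Set.range_subset_iff.2 fun i => (hp.1.1 i).1)))
        (span_le.2 (Set.range_subset_iff.2 hp.2.1))
  have hcard : ∀ U' ∈ T, ((indepTuples U (U' ⊓ (U ⊔ W)) d ×ˢ indepTuples (U ⊔ W) U' e).card : ℚ) =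
      (Fintype.card F : ℚ) ^ ((finrank F U + d) * d + (finrank F U + d + e) * e) *
        (qPoch (Fintype.card F) d * qPoch (Fintype.card F) e) := by
    intro U' hU'
    obtain ⟨h1, h2, h3⟩ := (hT U').1 hU'
    have hinf : finrank F ↥(U' ⊓ (U ⊔ W)) = finrank F U + d := by
      have := finrank_sup_add_finrank_inf_eq U' (U ⊔ W)
      rw [← sup_assoc, sup_eq_left.2 h2, h3, h1, hk] at this
      omega
    have hx := card_indepTuples U (U' ⊓ (U ⊔ W)) (r := d) (c := d)
      (by rw [inf_eq_left.2 (le_inf h2 le_sup_left), hinf, add_comm]) le_rfl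
    have hy := card_indepTuples (U ⊔ W) U' (r := e) (c := e)
      (by rw [inf_comm, hinf, h1, add_comm]) le_rfl
    rw [Nat.sub_self, show qPoch (Fintype.card F) 0 = 1 from Finset.prod_range_zero _,
      mul_one] at hx hy
    rw [Finset.card_product, Nat.cast_mul, hx, hy, hinf, h1]
    ring
  have hmaps : ((indepTuples U (U ⊔ W) d ×ˢ indepTuples (U ⊔ W) ⊤ e : Finset _) :
      Set ((Fin d → V) × (Fin e → V))).MapsTo φ T := fun p hp =>
    (hT _).2 ⟨(hrank p hp).1, le_sup_left.trans le_sup_left, (hrank p hp).2⟩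
  have hTcard : Nat.card {U' : Submodule F V // finrank F U' = finrank F U + d + e ∧ U ≤ U' ∧
        finrank F ↥(U' ⊔ W) = k + e} = T.card := Nat.subtype_card T hT
  rw [← Nat.cast_mul, ← Finset.card_product, Finset.card_eq_sum_card_fiberwise hmaps,
    Nat.cast_sum, Finset.sum_congr rfl fun U' hU' => (congrArg _ (congrArg _ (hfib U' hU'))).trans
      (hcard U' hU'), Finset.sum_const, nsmul_eq_mul, hTcard]

/-- The probability formula in terms of the dimensions `d`, `e`, `f`, `g` of the successive
subquotients determined by `U ≤ U' ⊓ (U ⊔ W)`, `U'`, `U' ⊔ W` and `V`. -/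
theorem card_subspaces_eq_mul {F V : Type*} [Field F] [Fintype F] [AddCommGroup V] [Module F V]
    [Finite V] (U W : Submodule F V) {j d e f g : ℕ} (hj : Module.finrank F U = j)
    (hk : Module.finrank F ↥(U ⊔ W) = j + d + f)
    (hn : Module.finrank F V = j + d + e + f + g) {q : ℚ} (hq : q = Fintype.card F) :
    (Nat.card {U' : Submodule F V // Module.finrank F U' = j + d + e ∧ U ≤ U' ∧
        Module.finrank F ↥(U' ⊔ W) = j + d + e + f} : ℚ) =
      (Nat.card {U' : Submodule F V // Module.finrank F U' = j + d + e ∧ U ≤ U'} : ℚ) *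
        ((q ^ (d * g))⁻¹ * (qPoch q (e + g) * qPoch q (f + g) * qPoch q (d + f) *
          qPoch q (d + e)) / (qPoch q d * qPoch q g * qPoch q (d + e + f + g) * qPoch q e *
            qPoch q f)) := by
  have hq1 : 1 < q := hq ▸ by exact_mod_cast Fintype.one_lt_card
  have hP := qPoch_ne_zero hq1
  have hP0 : qPoch q 0 = 1 := Finset.prod_range_zero _
  have hM := card_subspaces_mul U W (d := d) (e := e) hk
  have hN := card_subspaces_mul U ⊥ (k := j) (d := 0) (e := d + e) (by rw [sup_bot_eq, hj])
  have hT₁ := card_indepTuples U (U ⊔ W) (r := d) (c := d + f)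
    (by rw [inf_eq_left.2 le_sup_left, hj, hk]; ring) (by omega)
  have hT₂ := card_indepTuples (U ⊔ W) ⊤ (r := e) (c := e + g)
    (by rw [inf_top_eq, finrank_top, hk, hn]; ring) (by omega)
  have hT₃ := card_indepTuples U U (r := 0) (c := 0) (by rw [inf_idem, zero_add]) le_rfl
  have hT₄ := card_indepTuples U ⊤ (r := d + e) (c := d + e + f + g)
    (by rw [inf_top_eq, finrank_top, hj, hn]; ring) (by omega)
  have hiff : ∀ U' : Submodule F V, (Module.finrank F U' = j + 0 + (d + e) ∧ U ≤ U' ∧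
      Module.finrank F ↥(U' ⊔ ⊥) = j + (d + e)) ↔
      (Module.finrank F U' = j + d + e ∧ U ≤ U') := fun U' => by
    rw [sup_bot_eq, add_zero, ← add_assoc]
    tauto
  rw [sup_bot_eq, hj, Nat.card_congr (Equiv.subtypeEquivRight hiff)] at hN
  rw [hj, show j + d + f + e = j + d + e + f by ring] at hM
  rw [← hq] at hM hN hT₁ hT₂ hT₃ hT₄
  rw [hP0, mul_zero, pow_zero, one_mul, mul_one] at hT₃
  rw [hT₃, hP0, one_mul, one_mul] at hN
  rw [hk, Nat.add_sub_cancel_left, ← eq_div_iff (hP _)] at hT₁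
  rw [finrank_top, hn, Nat.add_sub_cancel_left, ← eq_div_iff (hP _)] at hT₂
  rw [finrank_top, hn, add_assoc (d + e), Nat.add_sub_cancel_left, ← add_assoc,
    ← eq_div_iff (hP _)] at hT₄
  have hq0 : q ≠ 0 := (zero_lt_one.trans hq1).ne'
  rw [hT₁, hT₂, ← eq_div_iff (mul_ne_zero (pow_ne_zero _ hq0) (mul_ne_zero (hP _) (hP _)))] at hM
  rw [hT₄, ← eq_div_iff (mul_ne_zero (pow_ne_zero _ hq0) (hP _))] at hN
  rw [hM, hN]
  have := hP d
  have := hP e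
  have := hP f
  have := hP g
  have := hP (d + e)
  have := hP (f + g)
  have := hP (d + e + f + g)
  field_simp
  ring

/-- If `U⁺` is chosen among the `l`-dimensional subspaces of `F^n` containing `U`, the number
of those with `dim (U⁺ + W) = m` equals `N · ℙ[m]`, where `N` is the total number of
`l`-dimensional subspaces containing `U`. -/
theorem statement4 {F : Type*} [Field F] [Fintype F] {n : ℕ}
    (U W : Submodule F (Fin n → F)) (j k l m : ℕ)
    (hj : Module.finrank F U = j) (hk : Module.finrank F ↥(U ⊔ W) = k)
    (hjl : j ≤ l) (hln : l ≤ n)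
    (hml : max k l ≤ m) (hmu : m ≤ min n (k + l - j)) :
    (Nat.card {U' : Submodule F (Fin n → F) //
        Module.finrank F U' = l ∧ U ≤ U' ∧ Module.finrank F ↥(U' ⊔ W) = m} : ℚ) =
      (Nat.card {U' : Submodule F (Fin n → F) // Module.finrank F U' = l ∧ U ≤ U'} : ℚ) *
        ((Fintype.card F : ℚ) ^ (((k : ℤ) + l - j - m) * ((m : ℤ) - n)) *
          (qPoch (Fintype.card F) (n - k) * qPoch (Fintype.card F) (n - l) *
            qPoch (Fintype.card F) (k - j) * qPoch (Fintype.card F) (l - j)) /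
          (qPoch (Fintype.card F) (k + l - j - m) * qPoch (Fintype.card F) (n - m) *
            qPoch (Fintype.card F) (n - j) * qPoch (Fintype.card F) (m - k) *
            qPoch (Fintype.card F) (m - l))) := by
  have hn : Module.finrank F (Fin n → F) = n := Module.finrank_fin_fun F
  have hjk : j ≤ k := hj ▸ hk ▸ Submodule.finrank_mono le_sup_left
  obtain ⟨d, hd⟩ : ∃ d, d = k + l - j - m := ⟨_, rfl⟩
  obtain ⟨e, rfl⟩ := Nat.exists_eq_add_of_le ((le_max_left _ _).trans hml)
  obtain ⟨f, hf⟩ := Nat.exists_eq_add_of_le ((le_max_right _ _).trans hml)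
  obtain ⟨g, hg⟩ := Nat.exists_eq_add_of_le (hmu.trans (min_le_left _ _))
  have hmu' := hmu.trans (min_le_right _ _)
  obtain rfl : l = j + d + e := by omega
  obtain rfl : k = j + d + f := by omega
  have hexp : (((j + d + f : ℕ) : ℤ) + (j + d + e : ℕ) - j - (j + d + f + e : ℕ)) *
      (((j + d + f + e : ℕ) : ℤ) - n) = -((d * g : ℕ) : ℤ) := by
    rw [hg]
    push_cast
    ring
  rw [hexp, zpow_neg, zpow_natCast, ← hd,
    show n - (j + d + f) = e + g by omega, show n - (j + d + e) = f + g by omega,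
    show j + d + f - j = d + f by omega, show j + d + e - j = d + e by omega,
    show n - (j + d + f + e) = g by omega, show n - j = d + e + f + g by omega,
    show j + d + f + e - (j + d + f) = e by omega, show j + d + f + e - (j + d + e) = f by omega,
    hf]
  exact card_subspaces_eq_mul U W hj hk (hn.trans (by omega)) rfl
end

section
/- Let π_n = R^{(𝔽_q)^n} = L^{(𝔽_q)^n} be the extension operator associated to the full space. Then π_n is multiplicative for the product of 𝒜(n, 𝔽_q): π_n(x * y) = π_n(x) * π_n(y) for all x, y ∈ 𝒜(n, 𝔽_q). The image of π_n is the span of the partial isomorphisms whose two underlying subspaces both equal (𝔽_q)^n; on such elements the product is ((𝔽_q)^n, (𝔽_q)^n, g₁, g₂) * ((𝔽_q)^n, (𝔽_q)^n, h₁, h₂) = ((𝔽_q)^n, (𝔽_q)^n, h₁ ∘ g₁, g₂ ∘ h₂), so the image is isomorphic as an algebra to the group algebra ℂ[GL(n, 𝔽_q) × GL(n, 𝔽_q)^op]. Moreover π_n is equivariant for the two-sided GL(n, 𝔽_q)-action on partial isomorphisms. -/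
/-- A partial isomorphism of `F^n`: a pair of linear isomorphisms
between two subspaces of the same dimension. -/
structure PartialIso (F : Type*) [Field F] (n : ℕ) where
  V : Submodule F (Fin n → F)
  W : Submodule F (Fin n → F)
  g₁ : V ≃ₗ[F] W
  g₂ : W ≃ₗ[F] V

variable {F : Type*} [Field F] {n : ℕ}

/-- `Q` is an extension of the partial isomorphism `P`. -/
def PartialIso.Extends (Q P : PartialIso F n) : Prop :=
  ∃ (hV : P.V ≤ Q.V) (hW : P.W ≤ Q.W),
    (∀ v : P.V, (Q.g₁ ⟨v.1, hV v.2⟩ : Fin n → F) = (P.g₁ v : Fin n → F)) ∧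
    (∀ w : P.W, (Q.g₂ ⟨w.1, hW w.2⟩ : Fin n → F) = (P.g₂ w : Fin n → F))

/-- `Q` is a trivial extension of `P`: the quotient isomorphisms
`Q.V/P.V → Q.W/P.W` and `Q.W/P.W → Q.V/P.V` induced by `Q.g₁` and `Q.g₂` are
mutually inverse; this is written out as the two coset conditions below. -/
def PartialIso.IsTrivialExt (P Q : PartialIso F n) : Prop :=
  Q.Extends P ∧
  (∀ v : Q.V, ((Q.g₂ (Q.g₁ v) : Fin n → F) - (v : Fin n → F)) ∈ P.V) ∧
  (∀ w : Q.W, ((Q.g₁ (Q.g₂ w) : Fin n → F) - (w : Fin n → F)) ∈ P.W)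

/-- The dimension of the space of fixed vectors of the composite automorphism `g₂ ∘ g₁` of `V`. -/
noncomputable def PartialIso.fixDim (P : PartialIso F n) : ℕ :=
  Module.finrank F
    (LinearMap.ker ((P.g₁.trans P.g₂).toLinearMap - (LinearMap.id : P.V →ₗ[F] P.V)))

open scoped Classical

/-- The complex vector space with basis the set of partial isomorphisms of `F^n`. -/
abbrev PIAlg (F : Type*) [Field F] (n : ℕ) := PartialIso F n →₀ ℂ

/-- `R_W^{W⁺}(P)`: the uniform average of the trivial extensions of `P` whose right
subspace equals `Wp` (left subspace arbitrary). -/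
noncomputable def avgR (P : PartialIso F n) (Wp : Submodule F (Fin n → F)) : PIAlg F n :=
  (Nat.card {Q : PartialIso F n // P.IsTrivialExt Q ∧ Q.W = Wp} : ℂ)⁻¹ •
    ∑ᶠ (Q : PartialIso F n) (_ : P.IsTrivialExt Q ∧ Q.W = Wp), Finsupp.single Q (1 : ℂ)

/-- `L_V^{V⁺}(P)`: the uniform average of the trivial extensions of `P` whose left
subspace equals `Vp` (right subspace arbitrary). -/
noncomputable def avgL (P : PartialIso F n) (Vp : Submodule F (Fin n → F)) : PIAlg F n :=
  (Nat.card {Q : PartialIso F n // P.IsTrivialExt Q ∧ Q.V = Vp} : ℂ)⁻¹ •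
    ∑ᶠ (Q : PartialIso F n) (_ : P.IsTrivialExt Q ∧ Q.V = Vp), Finsupp.single Q (1 : ℂ)

/-- Composition of two partial isomorphisms whose middle subspaces agree:
`(U,V,g₁,g₂)` and `(V,X,h₁,h₂)` compose to `(U,X,h₁∘g₁,g₂∘h₂)`. -/
def PartialIso.compo (A B : PartialIso F n) (h : A.W = B.V) : PartialIso F n where
  V := A.V
  W := B.W
  g₁ := (A.g₁.trans (LinearEquiv.ofEq _ _ h)).trans B.g₁
  g₂ := (B.g₂.trans (LinearEquiv.ofEq _ _ h.symm)).trans A.g₂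

/-- The pairing of two partial isomorphisms: their composition when the middle
subspaces agree, `0` otherwise. -/
noncomputable def pairTerm (A B : PartialIso F n) : PIAlg F n :=
  if h : A.W = B.V then Finsupp.single (A.compo B h) (1 : ℂ) else 0

/-- The product of two basis elements of `𝒜(n,F)`: the bilinear pairing of
`R_V^{V+W}(P)` with `L_W^{V+W}(Q)`. -/
noncomputable def mulBasis (P Q : PartialIso F n) : PIAlg F n :=
  (avgR P (P.W ⊔ Q.V)).sum fun A cA =>
    (avgL Q (P.W ⊔ Q.V)).sum fun B cB => (cA * cB) • pairTerm A B

/-- The product of the algebra `𝒜(n,F)` of partial isomorphisms. -/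
noncomputable def piMul (x y : PIAlg F n) : PIAlg F n :=
  x.sum fun P cP => y.sum fun Q cQ => (cP * cQ) • mulBasis P Q

/-- The empty partial isomorphism `({0},{0},id,id)`. -/
def PartialIso.unit (F : Type*) [Field F] (n : ℕ) : PartialIso F n :=
  ⟨⊥, ⊥, LinearEquiv.refl F _, LinearEquiv.refl F _⟩

/-- The extension operator `R^X`, as a linear endomorphism of `𝒜(n,F)`. -/
noncomputable def opR (X : Submodule F (Fin n → F)) : Module.End ℂ (PIAlg F n) :=
  Finsupp.linearCombination ℂ fun P : PartialIso F n => avgR P (P.W ⊔ X)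

/-- The extension operator `L^X`, as a linear endomorphism of `𝒜(n,F)`. -/
noncomputable def opL (X : Submodule F (Fin n → F)) : Module.End ℂ (PIAlg F n) :=
  Finsupp.linearCombination ℂ fun P : PartialIso F n => avgL P (P.V ⊔ X)

lemma map_comap_equiv (e : (Fin n → F) ≃ₗ[F] (Fin n → F)) (p : Submodule F (Fin n → F)) :
    (p.comap (e : (Fin n → F) →ₗ[F] (Fin n → F))).map (e : (Fin n → F) →ₗ[F] (Fin n → F)) = p :=
  Submodule.map_comap_eq_of_surjective e.surjective p

/-- The two-sided action of `GL(n, F)` (realized as linear automorphisms of `F^n`) on partial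
isomorphisms: `k · (V,W,g₁,g₂) · l = (k⁻¹(V), l⁻¹(W), l⁻¹∘g₁∘k, k⁻¹∘g₂∘l)`. -/
noncomputable def PartialIso.act (k l : (Fin n → F) ≃ₗ[F] (Fin n → F)) (P : PartialIso F n) :
    PartialIso F n where
  V := P.V.comap (k : (Fin n → F) →ₗ[F] (Fin n → F))
  W := P.W.comap (l : (Fin n → F) →ₗ[F] (Fin n → F))
  g₁ := (((k.submoduleMap (P.V.comap (k : (Fin n → F) →ₗ[F] (Fin n → F)))).trans
          (LinearEquiv.ofEq _ _ (map_comap_equiv k P.V))).trans P.g₁).trans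
        (((l.submoduleMap (P.W.comap (l : (Fin n → F) →ₗ[F] (Fin n → F)))).trans
          (LinearEquiv.ofEq _ _ (map_comap_equiv l P.W))).symm)
  g₂ := (((l.submoduleMap (P.W.comap (l : (Fin n → F) →ₗ[F] (Fin n → F)))).trans
          (LinearEquiv.ofEq _ _ (map_comap_equiv l P.W))).trans P.g₂).trans
        (((k.submoduleMap (P.V.comap (k : (Fin n → F) →ₗ[F] (Fin n → F)))).trans
          (LinearEquiv.ofEq _ _ (map_comap_equiv k P.V))).symm)

/-- The two-sided action of `GL(n,F)` on `𝒜(n,F)`, extended linearly. -/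
noncomputable def actA (k l : (Fin n → F) ≃ₗ[F] (Fin n → F)) (x : PIAlg F n) : PIAlg F n :=
  Finsupp.mapDomain (PartialIso.act k l) x

/-- The set `𝒵(n,F)` of elements of `𝒜(n,F)` invariant under the two-sided
`GL(n,F)`-action. -/
def Zset (F : Type*) [Field F] (n : ℕ) : Set (PIAlg F n) :=
  {x | ∀ k l : (Fin n → F) ≃ₗ[F] (Fin n → F), actA k l x = x}

/-- Pairs of automorphisms of `F^n`, with the composition law of total partial isomorphisms. -/
abbrev GLPair (F : Type*) [Field F] (n : ℕ) :=
  ((Fin n → F) ≃ₗ[F] (Fin n → F)) × ((Fin n → F) ≃ₗ[F] (Fin n → F))ᵐᵒᵖ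

namespace GLPair

/-- The automorphism playing the role of `g₁`. -/
def fwd (x : GLPair F n) : (Fin n → F) ≃ₗ[F] (Fin n → F) := x.2.unop

/-- The automorphism playing the role of `g₂`. -/
def bwd (x : GLPair F n) : (Fin n → F) ≃ₗ[F] (Fin n → F) := x.1

@[simp] lemma fwd_mk (f g : (Fin n → F) ≃ₗ[F] (Fin n → F)) :
    fwd ((g, MulOpposite.op f) : GLPair F n) = f := rfl

@[simp] lemma bwd_mk (f g : (Fin n → F) ≃ₗ[F] (Fin n → F)) :
    bwd ((g, MulOpposite.op f) : GLPair F n) = g := rfl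

@[simp] lemma fwd_mul (x y : GLPair F n) (v : Fin n → F) :
    (x * y).fwd v = y.fwd (x.fwd v) := rfl

@[simp] lemma bwd_mul (x y : GLPair F n) (v : Fin n → F) :
    (x * y).bwd v = x.bwd (y.bwd v) := rfl

@[simp] lemma fwd_inv (x : GLPair F n) (v : Fin n → F) : (x⁻¹).fwd v = x.fwd.symm v := rfl

@[simp] lemma bwd_inv (x : GLPair F n) (v : Fin n → F) : (x⁻¹).bwd v = x.bwd.symm v := rfl

/-- The pairs fixing `M` pointwise whose two composites are trivial modulo `W`. -/
def fixer (W M : Submodule F (Fin n → F)) : Set (GLPair F n) :=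
  {k | (∀ m ∈ M, k.fwd m = m) ∧ (∀ m ∈ M, k.bwd m = m) ∧
    (∀ v, k.bwd (k.fwd v) - v ∈ W) ∧ ∀ v, k.fwd (k.bwd v) - v ∈ W}

/-- The pairs extending `A` whose two composites are trivial modulo `P`. -/
def lifts (P A : PartialIso F n) : Set (GLPair F n) :=
  {x | (∀ v : A.V, x.fwd v = A.g₁ v) ∧ (∀ w : A.W, x.bwd w = A.g₂ w) ∧
    (∀ v, x.bwd (x.fwd v) - v ∈ P.V) ∧ ∀ w, x.fwd (x.bwd w) - w ∈ P.W}

section lifts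

variable {P A : PartialIso F n} {x z k : GLPair F n}

lemma lifts_subset_lifts_self (h : A.Extends P) : lifts P A ⊆ lifts P P := by
  obtain ⟨hV, hW, h1, h2⟩ := h
  rintro x ⟨a, b, c, d⟩
  exact ⟨fun v => (a ⟨v, hV v.2⟩).trans (h1 v), fun w => (b ⟨w, hW w.2⟩).trans (h2 w), c, d⟩

lemma lifts_subset_lifts_ext (h : A.Extends P) : lifts P A ⊆ lifts A A := by
  obtain ⟨hV, hW, h1, h2⟩ := h
  rintro x ⟨a, b, c, d⟩
  exact ⟨a, b, fun v => hV (c v), fun w => hW (d w)⟩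

lemma extends_refl (P : PartialIso F n) : P.Extends P :=
  ⟨le_rfl, le_rfl, fun _ => rfl, fun _ => rfl⟩

lemma fwd_mem_iff (hx : x ∈ lifts P P) (v : Fin n → F) : x.fwd v ∈ P.W ↔ v ∈ P.V := by
  constructor
  · intro h
    obtain ⟨u, hu⟩ := P.g₁.surjective ⟨_, h⟩
    have := hx.1 u
    rw [hu] at this
    rw [← x.fwd.injective this]
    exact u.2
  · intro h
    rw [hx.1 ⟨v, h⟩]
    exact (P.g₁ _).2

lemma bwd_mem_iff (hx : x ∈ lifts P P) (v : Fin n → F) : x.bwd v ∈ P.V ↔ v ∈ P.W := by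
  constructor
  · intro h
    obtain ⟨u, hu⟩ := P.g₂.surjective ⟨_, h⟩
    have := hx.2.1 u
    rw [hu] at this
    rw [← x.bwd.injective this]
    exact u.2
  · intro h
    rw [hx.2.1 ⟨v, h⟩]
    exact (P.g₂ _).2

lemma mem_lifts_iff_inv_mul (h : A.Extends P) (hx : x ∈ lifts P A) :
    z ∈ lifts P A ↔ x⁻¹ * z ∈ fixer P.W A.W := by
  have hP := lifts_subset_lifts_self h hx
  obtain ⟨hV, hW, hg₁, -⟩ := h
  have e3 (v) : x.bwd ((x⁻¹ * z).bwd ((x⁻¹ * z).fwd (x.fwd v)) - x.fwd v)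
      = (z.bwd (z.fwd v) - v) - (x.bwd (x.fwd v) - v) := by simp
  constructor
  · intro hz
    have h3 : ∀ v, (x⁻¹ * z).bwd ((x⁻¹ * z).fwd v) - v ∈ P.W := by
      intro v
      obtain ⟨v, rfl⟩ := x.fwd.surjective v
      rw [← bwd_mem_iff hP, e3]
      exact P.V.sub_mem (hz.2.2.1 v) (hx.2.2.1 v)
    have h1 : ∀ m ∈ A.W, (x⁻¹ * z).fwd m = m := by
      intro m hm
      obtain ⟨u, hu⟩ := A.g₁.surjective ⟨m, hm⟩
      have e := hx.1 u
      have e' := hz.1 u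
      rw [hu] at e e'
      simp only [fwd_mul, fwd_inv]
      rw [show m = x.fwd u from e.symm, LinearEquiv.symm_apply_apply, e, e']
    refine ⟨h1, ?_, h3, ?_⟩
    · intro m hm
      simp only [bwd_mul, bwd_inv]
      rw [hz.2.1 ⟨m, hm⟩, ← hx.2.1 ⟨m, hm⟩, LinearEquiv.symm_apply_apply]
    · intro v
      obtain ⟨v, rfl⟩ := (x⁻¹ * z).fwd.surjective v
      rw [← map_sub, h1 _ (hW (h3 v))]
      exact h3 v
  · intro hk
    have h3 : ∀ v, z.bwd (z.fwd v) - v ∈ P.V := by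
      intro v
      have := P.V.add_mem ((bwd_mem_iff hP _).2 (hk.2.2.1 (x.fwd v))) (hx.2.2.1 v)
      rw [e3] at this
      simpa using this
    have h1 : ∀ v : A.V, z.fwd v = A.g₁ v := by
      intro v
      have := hk.1 (A.g₁ v) (A.g₁ v).2
      rw [← hx.1] at this
      simpa [← hx.1] using this
    have h2 : ∀ w : A.W, z.bwd w = A.g₂ w := by
      intro w
      have := congrArg x.bwd (hk.2.1 w w.2)
      simpa [← hx.2.1] using this
    refine ⟨h1, h2, h3, fun w => ?_⟩
    obtain ⟨v, rfl⟩ := z.fwd.surjective w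
    rw [← map_sub]
    have h' := h3 v
    rw [h1 ⟨_, hV h'⟩, hg₁ ⟨_, h'⟩]
    exact (P.g₁ _).2

/-- Exchanging the two automorphisms of a pair. -/
def flip (x : GLPair F n) : GLPair F n := (x.fwd, MulOpposite.op x.bwd)

lemma flip_mul (x y : GLPair F n) : (x * y).flip = y.flip * x.flip := rfl

lemma flip_inv (x : GLPair F n) : (x⁻¹).flip = (x.flip)⁻¹ := rfl

lemma flip_mem_fixer {W M : Submodule F (Fin n → F)} :
    k.flip ∈ fixer W M ↔ k ∈ fixer W M :=
  ⟨fun h => ⟨h.2.1, h.1, h.2.2.2, h.2.2.1⟩, fun h => ⟨h.2.1, h.1, h.2.2.2, h.2.2.1⟩⟩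

/-- Exchanging the two sides of a partial isomorphism. -/
def _root_.PartialIso.flip (P : PartialIso F n) : PartialIso F n := ⟨P.W, P.V, P.g₂, P.g₁⟩

lemma flip_extends_flip (h : A.Extends P) : A.flip.Extends P.flip := by
  obtain ⟨hV, hW, h1, h2⟩ := h
  exact ⟨hW, hV, h2, h1⟩

lemma flip_mem_lifts : x.flip ∈ lifts P.flip A.flip ↔ x ∈ lifts P A :=
  ⟨fun h => ⟨h.2.1, h.1, h.2.2.2, h.2.2.1⟩, fun h => ⟨h.2.1, h.1, h.2.2.2, h.2.2.1⟩⟩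

lemma mem_lifts_iff_mul_inv (h : A.Extends P) (hx : x ∈ lifts P A) :
    z ∈ lifts P A ↔ z * x⁻¹ ∈ fixer P.V A.V := by
  rw [← flip_mem_lifts, mem_lifts_iff_inv_mul (flip_extends_flip h) (flip_mem_lifts.2 hx),
    ← flip_mem_fixer (k := z * x⁻¹), flip_mul, flip_inv]
  rfl

/-- The lifts of a composite are obtained by inserting, between lifts of the factors, a pair
acting trivially on the middle subspace. -/
lemma mul_mul_mem_lifts_compo {A B : PartialIso F n} {y : GLPair F n} (h : A.W = B.V)
    (hx : x ∈ lifts A A) (hy : y ∈ lifts B B) :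
    x * k * y ∈ lifts (A.compo B h) (A.compo B h) ↔ k ∈ fixer A.W A.W := by
  have hxy : x * y ∈ lifts (A.compo B h) (A.compo B h) := by
    have h1 (v : (A.compo B h).V) : (x * y).fwd v = (A.compo B h).g₁ v := by
      rw [fwd_mul, hx.1 v]
      exact hy.1 ⟨_, h ▸ (A.g₁ v).2⟩
    have h2 (w : (A.compo B h).W) : (x * y).bwd w = (A.compo B h).g₂ w := by
      rw [bwd_mul, hy.2.1 w]
      exact hx.2.1 ⟨_, by rw [h]; exact (B.g₂ w).2⟩
    refine ⟨h1, h2, fun v => ?_, fun w => ?_⟩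
    · have := A.V.add_mem ((bwd_mem_iff hx _).2 (h ▸ hy.2.2.1 (x.fwd v))) (hx.2.2.1 v)
      change _ ∈ A.V
      simpa using this
    · have := B.W.add_mem ((fwd_mem_iff hy _).2 (h ▸ hx.2.2.2 (y.bwd w))) (hy.2.2.2 w)
      change _ ∈ B.W
      simpa using this
  rw [mem_lifts_iff_inv_mul (extends_refl _) hxy,
    show (x * y)⁻¹ * (x * k * y) = y⁻¹ * (k * y) by group]
  change _ ∈ fixer B.W B.W ↔ _
  rw [← mem_lifts_iff_inv_mul (extends_refl _) hy, mem_lifts_iff_mul_inv (extends_refl _) hy,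
    mul_inv_cancel_right, h]

end lifts

end GLPair

section Extension

variable {E : Type*} [AddCommGroup E] [Module F E]

lemma exists_linearEquiv_glue {V C W D : Submodule F E} (hVC : IsCompl V C) (hWD : IsCompl W D)
    (e : V ≃ₗ[F] W) (f : C ≃ₗ[F] D) :
    ∃ T : E ≃ₗ[F] E, ∀ (v : V) (c : C), T (v + c) = e v + f c := by
  refine ⟨((Submodule.prodEquivOfIsCompl V C hVC).symm.trans (e.prodCongr f)).trans
    (Submodule.prodEquivOfIsCompl W D hWD), fun v c => ?_⟩
  have : (v + c : E) = Submodule.prodEquivOfIsCompl V C hVC (v, c) := by simp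
  rw [this]
  simp only [LinearEquiv.trans_apply, LinearEquiv.symm_apply_apply]
  simp

lemma exists_linearEquiv_extend [FiniteDimensional F E] {V W : Submodule F E} (e : V ≃ₗ[F] W) :
    ∃ T : E ≃ₗ[F] E, ∀ v : V, T v = e v := by
  obtain ⟨C, hC⟩ := V.exists_isCompl
  obtain ⟨D, hD⟩ := W.exists_isCompl
  have h1 := Submodule.finrank_add_eq_of_isCompl hC
  have h2 := Submodule.finrank_add_eq_of_isCompl hD
  have h3 := e.finrank_eq
  obtain ⟨T, hT⟩ := exists_linearEquiv_glue hC hD e (LinearEquiv.ofFinrankEq C D (by omega))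
  exact ⟨T, fun v => by simpa using hT v 0⟩

lemma exists_linearEquiv_extend_trivially {W : Submodule F E} (e : W ≃ₗ[F] W) :
    ∃ T : E ≃ₗ[F] E, (∀ w : W, T w = e w) ∧ ∀ v, ∃ w : W, T v - v = e w - w := by
  obtain ⟨C, hC⟩ := W.exists_isCompl
  obtain ⟨T, hT⟩ := exists_linearEquiv_glue hC hC e (LinearEquiv.refl F C)
  refine ⟨T, fun v => by simpa using hT v 0, fun v => ?_⟩
  obtain ⟨⟨w, c⟩, rfl⟩ := (Submodule.prodEquivOfIsCompl W C hC).surjective v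
  exact ⟨w, by simp [hT]⟩

lemma exists_linearMap_decompose {V W : Submodule F E} (N : E →ₗ[F] E)
    (hN : ∀ v, N v ∈ W ⊔ V) :
    ∃ N' : E →ₗ[F] E, (∀ v, N' v ∈ W) ∧ (∀ v, N v - N' v ∈ V) ∧ ∀ v, N v = 0 → N' v = 0 := by
  set f := W.subtype.coprod V.subtype
  have hf : LinearMap.range f = W ⊔ V := by simp [f, LinearMap.range_coprod]
  obtain ⟨s, hs⟩ := f.rangeRestrict.exists_rightInverse_of_surjective f.range_rangeRestrict
  set N₁ := N.codRestrict (LinearMap.range f) (fun v => hf ▸ hN v)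
  refine ⟨W.subtype ∘ₗ LinearMap.fst F W V ∘ₗ s ∘ₗ N₁, fun v => (s (N₁ v)).1.2, fun v => ?_,
    fun v hv => ?_⟩
  · have h := congrArg Subtype.val (LinearMap.congr_fun hs (N₁ v))
    have h' : ((s (N₁ v)).1 : E) + (s (N₁ v)).2 = N v := h
    rw [← h']
    simp
  · have : N₁ v = 0 := Subtype.ext hv
    simp [this]

end Extension

namespace GLPair

variable {P A : PartialIso F n} {x k : GLPair F n}

lemma lifts_nonempty (h : P.IsTrivialExt A) : (lifts P A).Nonempty := by
  obtain ⟨⟨hV, hW, hg₁, -⟩, h1, h2⟩ := h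
  obtain ⟨f, hf⟩ := exists_linearEquiv_extend A.g₁
  obtain ⟨T, hT, hT'⟩ := exists_linearEquiv_extend_trivially (A.g₂.trans A.g₁)
  have h4 : ∀ w, T w - w ∈ P.W := fun w => by
    obtain ⟨m, hm⟩ := hT' w
    rw [hm]
    exact h2 m
  refine ⟨(T.trans f.symm, MulOpposite.op f), hf, fun w => ?_, fun v => ?_, fun w => ?_⟩
  · simp [hT, LinearEquiv.symm_apply_eq, hf]
  · obtain ⟨u, hu⟩ := P.g₁.surjective ⟨_, h4 (f v)⟩
    have : f.symm (T (f v) - f v) = u := by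
      rw [LinearEquiv.symm_apply_eq, hf ⟨u, hV u.2⟩, hg₁, hu]
    rw [map_sub, LinearEquiv.symm_apply_apply] at this
    simp [this]
  · simpa using h4 w

lemma exists_restrict (hx : x ∈ lifts P P) {M : Submodule F (Fin n → F)} (hM : P.W ≤ M) :
    ∃ A, P.IsTrivialExt A ∧ A.W = M ∧ x ∈ lifts P A := by
  have hfwd : (M.comap (x.fwd : (Fin n → F) →ₗ[F] (Fin n → F))).map
      (x.fwd : (Fin n → F) →ₗ[F] (Fin n → F)) = M := map_comap_equiv _ _
  have hbwd : M.map (x.bwd : (Fin n → F) →ₗ[F] (Fin n → F))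
      = M.comap (x.fwd : (Fin n → F) →ₗ[F] (Fin n → F)) := by
    ext v
    obtain ⟨w, rfl⟩ := x.bwd.surjective v
    have := hM (hx.2.2.2 w)
    simp only [Submodule.mem_map, Submodule.mem_comap, LinearEquiv.coe_coe,
      EmbeddingLike.apply_eq_iff_eq, exists_eq_right]
    exact ⟨fun h => by simpa using M.add_mem this h, fun h => by simpa using M.sub_mem h this⟩
  refine ⟨⟨_, M, x.fwd.ofSubmodules _ _ hfwd, x.bwd.ofSubmodules _ _ hbwd⟩,
    ⟨⟨fun v hv => hM ((fwd_mem_iff hx v).2 hv), hM, hx.1, hx.2.1⟩,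
      fun v => hx.2.2.1 v, fun w => hx.2.2.2 w⟩, rfl, fun _ => rfl, fun _ => rfl, hx.2.2⟩

lemma eq_of_mem_lifts {B : PartialIso F n} (hA : x ∈ lifts A A) (hB : x ∈ lifts B B)
    (h : A.W = B.W) : A = B := by
  have hV : A.V = B.V := by
    ext v
    rw [← fwd_mem_iff hA, ← fwd_mem_iff hB, h]
  obtain ⟨V, W, a, b⟩ := A
  obtain ⟨V', W', c, d⟩ := B
  obtain rfl : V = V' := hV
  obtain rfl : W = W' := h
  congr 1
  · ext1 v
    exact Subtype.ext ((hA.1 v).symm.trans (hB.1 v))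
  · ext1 v
    exact Subtype.ext ((hA.2.1 v).symm.trans (hB.2.1 v))

lemma exists_mul_of_mem_fixer_sup {V W : Submodule F (Fin n → F)}
    (hk : k ∈ fixer (W ⊔ V) (W ⊔ V)) : ∃ a ∈ fixer W W, ∃ b ∈ fixer V V, k = a * b := by
  obtain ⟨h1, h2, h3, -⟩ := hk
  set N : (Fin n → F) →ₗ[F] (Fin n → F) :=
    (k.fwd.trans k.bwd : (Fin n → F) →ₗ[F] (Fin n → F)) - LinearMap.id with hN
  have hN0 : ∀ m ∈ W ⊔ V, N m = 0 := fun m hm => by simp [hN, h1 m hm, h2 m hm]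
  obtain ⟨N', hW, hV, hN'⟩ := exists_linearMap_decompose (V := V) (W := W) N h3
  have hsq : ∀ v, N' (N' v) = 0 := fun v => hN' _ (hN0 _ (Submodule.mem_sup_left (hW v)))
  set a₂ : (Fin n → F) ≃ₗ[F] (Fin n → F) :=
    LinearEquiv.ofLinearMap (LinearMap.id + N') (LinearMap.id - N')
      (LinearMap.ext fun v => by simp [hsq]) (LinearMap.ext fun v => by simp [hsq]) with ha₂
  have ha (v) : a₂ v = v + N' v := rfl
  have hs (m) (hm : m ∈ W ⊔ V) : a₂.symm m = m := by
    rw [LinearEquiv.symm_apply_eq, ha, hN' _ (hN0 _ hm), add_zero]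
  refine ⟨(a₂, 1), ⟨fun m _ => rfl, fun m hm => ?_, fun v => ?_, fun v => ?_⟩,
    (a₂⁻¹ * k.bwd, MulOpposite.op k.fwd), ⟨fun m hm => ?_, fun m hm => ?_, ?_⟩, ?_⟩
  · exact (ha m).trans (by simp [hN' _ (hN0 _ (Submodule.mem_sup_left hm))])
  · change a₂ v - v ∈ W
    simpa [ha] using hW v
  · change a₂ v - v ∈ W
    simpa [ha] using hW v
  · exact h1 m (Submodule.mem_sup_right hm)
  · change a₂.symm (k.bwd m) = m
    rw [h2 m (Submodule.mem_sup_right hm), hs m (Submodule.mem_sup_right hm)]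
  · have h3 : ∀ v, a₂.symm (k.bwd (k.fwd v)) - v ∈ V := fun v => by
      have : a₂.symm (k.bwd (k.fwd v)) - v = N v - N' v := by
        have h := hs _ (Submodule.mem_sup_right (hV v))
        rw [LinearEquiv.symm_apply_eq] at h
        rw [sub_eq_iff_eq_add, LinearEquiv.symm_apply_eq, map_add, ← h, ha]
        simp [hN]
      rw [this]
      exact hV v
    refine ⟨h3, fun v => ?_⟩
    obtain ⟨v, rfl⟩ := k.fwd.surjective v
    change k.fwd (a₂.symm (k.bwd (k.fwd v))) - k.fwd v ∈ V
    rw [← map_sub, h1 _ (Submodule.mem_sup_right (h3 v))]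
    exact h3 v
  · refine Prod.ext ?_ ?_
    · change k.bwd = a₂ * (a₂⁻¹ * k.bwd)
      rw [mul_inv_cancel_left]
    · rfl

end GLPair

section Mean

variable {α β M N : Type*} [AddCommGroup M] [Module ℂ M] [AddCommGroup N] [Module ℂ N]

/-- The uniform average of `f` over `S`. -/
noncomputable def mean (S : Set α) (f : α → M) : M := (Nat.card S : ℂ)⁻¹ • ∑ᶠ a ∈ S, f a

lemma mean_congr {S : Set α} {f g : α → M} (h : ∀ a ∈ S, f a = g a) : mean S f = mean S g := by
  rw [mean, mean, finsum_mem_congr rfl h]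

lemma mean_image {g : α → β} (hg : Function.Injective g) (S : Set α) (f : β → M) :
    mean (g '' S) f = mean S fun a => f (g a) := by
  rw [mean, mean, finsum_mem_image hg.injOn, Nat.card_image_of_injective hg]

variable [Finite α] [Finite β]

lemma mean_eq_sum (S : Set α) (f : α → M) :
    mean S f = (Nat.card S : ℂ)⁻¹ • ∑ a ∈ S.toFinite.toFinset, f a := by
  rw [mean, finsum_mem_eq_finite_toFinset_sum]

lemma map_mean (L : M →ₗ[ℂ] N) (S : Set α) (f : α → M) :
    L (mean S f) = mean S fun a => L (f a) := by
  simp [mean_eq_sum]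

lemma mean_const {S : Set α} (hS : S.Nonempty) (c : M) : mean S (fun _ => c) = c := by
  have : (Nat.card S : ℂ) ≠ 0 := by
    have := hS.to_subtype
    exact_mod_cast Nat.card_pos.ne'
  rw [mean_eq_sum, Finset.sum_const, ← Nat.cast_smul_eq_nsmul ℂ, ← Set.ncard_eq_toFinset_card,
    ← Nat.card_coe_set_eq, smul_smul, inv_mul_cancel₀ this, one_smul]

lemma mean_mem {S : Set α} {f : α → M} {p : Submodule ℂ M} (h : ∀ a ∈ S, f a ∈ p) :
    mean S f ∈ p := by
  rw [mean_eq_sum]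
  exact p.smul_mem _ (p.sum_mem fun a ha => h a (by simpa using ha))

lemma mean_comm (S : Set α) (T : Set β) (f : α → β → M) :
    mean S (fun a => mean T (f a)) = mean T fun b => mean S fun a => f a b := by
  simp only [mean_eq_sum, ← Finset.smul_sum]
  rw [smul_comm, Finset.sum_comm]

/-- An average may be computed upstairs along a map whose fibres have constant cardinality. -/
lemma mean_eq_mean_of_card_fiber {S : Set α} {R : Set β} {ρ : α → β} (hρ : Set.MapsTo ρ S R)
    {c : ℕ} (hc : c ≠ 0) (hcard : ∀ b ∈ R, Nat.card {a | a ∈ S ∧ ρ a = b} = c) (φ : β → M) :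
    mean R φ = mean S fun a => φ (ρ a) := by
  have hfib : ∀ b ∈ R.toFinite.toFinset,
      (S.toFinite.toFinset.filter fun a => ρ a = b).card = c := fun b hb => by
    rw [← hcard b (by simpa using hb), Nat.card_coe_set_eq, Set.ncard_eq_toFinset_card]
    congr 1
    ext a
    simp
  have hmaps : ∀ a ∈ S.toFinite.toFinset, ρ a ∈ R.toFinite.toFinset := fun a ha => by
    simpa using hρ (by simpa using ha)
  have hSR : Nat.card S = Nat.card R * c := by
    rw [Nat.card_coe_set_eq, Nat.card_coe_set_eq, Set.ncard_eq_toFinset_card S,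
      Set.ncard_eq_toFinset_card R, Finset.card_eq_sum_card_fiberwise hmaps,
      Finset.sum_congr rfl hfib, Finset.sum_const, smul_eq_mul]
  have hsum : ∑ a ∈ S.toFinite.toFinset, φ (ρ a)
      = (c : ℂ) • ∑ b ∈ R.toFinite.toFinset, φ b := by
    rw [← Finset.sum_fiberwise_of_maps_to hmaps, Finset.smul_sum]
    refine Finset.sum_congr rfl fun b hb => ?_
    rw [Finset.sum_congr rfl (g := fun _ => φ b)
      (fun a ha => by rw [(Finset.mem_filter.1 ha).2]), Finset.sum_const, hfib b hb,
      Nat.cast_smul_eq_nsmul]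
  have hc' : (c : ℂ) ≠ 0 := by exact_mod_cast hc
  rw [mean_eq_sum, mean_eq_sum, hsum, hSR, smul_smul]
  congr 1
  push_cast
  rw [mul_inv, mul_assoc, inv_mul_cancel₀ hc', mul_one]

end Mean

instance [Finite F] : Finite (PartialIso F n) := by
  have hf (V W : Submodule F (Fin n → F)) : Finite (V ≃ₗ[F] W) := DFunLike.finite _
  have : Finite (Submodule F (Fin n → F)) := Finite.of_injective _ SetLike.coe_injective
  refine Finite.of_surjective (α := Σ V W : Submodule F (Fin n → F), (V ≃ₗ[F] W) × (W ≃ₗ[F] V))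
    (fun t => ⟨t.1, t.2.1, t.2.2.1, t.2.2.2⟩) fun P => ⟨⟨P.V, P.W, P.g₁, P.g₂⟩, rfl⟩

instance [Finite F] : Finite (GLPair F n) := by
  have : Finite ((Fin n → F) ≃ₗ[F] (Fin n → F)) := DFunLike.finite _
  have := Finite.of_equiv ((Fin n → F) ≃ₗ[F] (Fin n → F)) MulOpposite.opEquiv
  exact Finite.instProd

lemma avgR_eq_mean (P : PartialIso F n) (M : Submodule F (Fin n → F)) :
    avgR P M = mean {Q | P.IsTrivialExt Q ∧ Q.W = M} fun Q => Finsupp.single Q (1 : ℂ) := rfl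

lemma avgL_eq_mean (P : PartialIso F n) (M : Submodule F (Fin n → F)) :
    avgL P M = mean {Q | P.IsTrivialExt Q ∧ Q.V = M} fun Q => Finsupp.single Q (1 : ℂ) := rfl

namespace GLPair

/-- The partial isomorphism with both underlying subspaces total attached to a pair. -/
def full (x : GLPair F n) : PartialIso F n where
  V := ⊤
  W := ⊤
  g₁ := (Submodule.topEquiv.trans x.fwd).trans Submodule.topEquiv.symm
  g₂ := (Submodule.topEquiv.trans x.bwd).trans Submodule.topEquiv.symm

variable {P A : PartialIso F n} {x k : GLPair F n}

lemma mem_lifts_full (x : GLPair F n) : x ∈ lifts x.full x.full :=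
  ⟨fun _ => rfl, fun _ => rfl, fun _ => trivial, fun _ => trivial⟩

lemma full_injective : Function.Injective (full : GLPair F n → PartialIso F n) := by
  intro x y h
  have hx := mem_lifts_full x
  have hy := h ▸ mem_lifts_full y
  refine Prod.ext (LinearEquiv.ext fun v => ?_)
    (MulOpposite.unop_injective (LinearEquiv.ext fun v => ?_))
  · exact (hx.2.1 ⟨v, trivial⟩).trans (hy.2.1 ⟨v, trivial⟩).symm
  · exact (hx.1 ⟨v, trivial⟩).trans (hy.1 ⟨v, trivial⟩).symm

lemma full_eq (hx : x ∈ lifts P P) (hW : P.W = ⊤) : x.full = P :=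
  eq_of_mem_lifts (mem_lifts_full x) hx hW.symm

lemma image_full_lifts (P : PartialIso F n) :
    full '' lifts P P = {Q | P.IsTrivialExt Q ∧ Q.W = ⊤} := by
  ext Q
  constructor
  · rintro ⟨x, hx, rfl⟩
    exact ⟨⟨⟨le_top, le_top, hx.1, hx.2.1⟩, fun v => hx.2.2.1 v, fun w => hx.2.2.2 w⟩, rfl⟩
  · rintro ⟨hQ, hW⟩
    obtain ⟨x, hx⟩ := lifts_nonempty hQ
    exact ⟨x, lifts_subset_lifts_self hQ.1 hx, full_eq (lifts_subset_lifts_ext hQ.1 hx) hW⟩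

lemma _root_.PartialIso.V_eq_top_iff (P : PartialIso F n) : P.V = ⊤ ↔ P.W = ⊤ := by
  have := P.g₁.finrank_eq
  constructor <;> intro h <;> apply Submodule.eq_top_of_finrank_eq
  · rw [← this, h, finrank_top]
  · rw [this, h, finrank_top]

lemma _root_.avgR_top (P : PartialIso F n) :
    avgR P ⊤ = mean (lifts P P) fun x => Finsupp.single x.full (1 : ℂ) := by
  rw [avgR_eq_mean, ← image_full_lifts, mean_image full_injective]

lemma _root_.avgL_top (P : PartialIso F n) : avgL P ⊤ = avgR P ⊤ := by
  simp only [avgL_eq_mean, avgR_eq_mean, PartialIso.V_eq_top_iff]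

lemma _root_.opR_top_single (P : PartialIso F n) :
    opR ⊤ (Finsupp.single P 1) = mean (lifts P P) fun x => Finsupp.single x.full (1 : ℂ) := by
  simp [opR, avgR_top]

lemma _root_.PartialIso.isTrivialExt_self (P : PartialIso F n) (hW : P.W = ⊤) :
    P.IsTrivialExt P :=
  ⟨extends_refl P, fun _ => (P.V_eq_top_iff.2 hW).ge trivial, fun _ => hW.ge trivial⟩

lemma _root_.avgR_top_of_eq_top [Finite F] (hW : P.W = ⊤) :
    avgR P ⊤ = Finsupp.single P 1 := by
  rw [avgR_top, mean_congr (g := fun _ => Finsupp.single P 1) fun x hx => by rw [full_eq hx hW],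
    mean_const (lifts_nonempty (P.isTrivialExt_self hW))]

end GLPair

section Bilinear

variable {α β S T : Type*} {M : Type*} [AddCommGroup M] [Module ℂ M]

/-- The bilinear extension of a map defined on pairs of basis elements. -/
noncomputable def bilinExt (f : α → β → M) : (α →₀ ℂ) →ₗ[ℂ] (β →₀ ℂ) →ₗ[ℂ] M :=
  Finsupp.linearCombination ℂ fun a => Finsupp.linearCombination ℂ (f a)

lemma sum_sum_eq_bilinExt (f : α → β → M) (x : α →₀ ℂ) (y : β →₀ ℂ) :
    (x.sum fun a c => y.sum fun b d => (c * d) • f a b) = bilinExt f x y := by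
  simp [bilinExt, Finsupp.linearCombination_apply, Finsupp.sum, LinearMap.sum_apply,
    Finset.smul_sum, smul_smul]

lemma bilinExt_single (f : α → β → M) (a : α) (b : β) :
    bilinExt f (Finsupp.single a 1) (Finsupp.single b 1) = f a b := by
  simp [bilinExt]

lemma bilinExt_mean [Finite S] [Finite T] (f : α → β → M) (s : Set S) (t : Set T)
    (a : S → α) (b : T → β) :
    bilinExt f (mean s fun i => Finsupp.single (a i) 1) (mean t fun j => Finsupp.single (b j) 1) =
      mean s fun i => mean t fun j => f (a i) (b j) := by
  rw [← LinearMap.flip_apply, map_mean ((bilinExt f).flip _)]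
  refine mean_congr fun i _ => ?_
  rw [LinearMap.flip_apply, map_mean]
  simp only [bilinExt_single]

end Bilinear

lemma piMul_eq_bilinExt (x y : PIAlg F n) : piMul x y = bilinExt mulBasis x y :=
  sum_sum_eq_bilinExt _ _ _

lemma mulBasis_eq_bilinExt (P Q : PartialIso F n) :
    mulBasis P Q = bilinExt pairTerm (avgR P (P.W ⊔ Q.V)) (avgL Q (P.W ⊔ Q.V)) :=
  sum_sum_eq_bilinExt _ _ _

namespace GLPair

variable {P Q A : PartialIso F n} {x k : GLPair F n} {M : Submodule F (Fin n → F)}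
  {N : Type*} [AddCommGroup N] [Module ℂ N]

lemma card_lifts (h : P.IsTrivialExt A) : Nat.card (lifts P A) = Nat.card (fixer P.W A.W) := by
  obtain ⟨x, hx⟩ := lifts_nonempty h
  rw [← Nat.card_image_of_injective (mul_right_injective x) (fixer P.W A.W)]
  congr 2
  ext z
  rw [mem_lifts_iff_inv_mul h.1 hx]
  simp

lemma one_mem_fixer (W M : Submodule F (Fin n → F)) : (1 : GLPair F n) ∈ fixer W M :=
  ⟨fun _ _ => rfl, fun _ _ => rfl, fun v => by simp [fwd, bwd], fun v => by simp [fwd, bwd]⟩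

/-- An average over the trivial extensions of `P` with right subspace `M` is an average over
the total trivial extensions of `P`, each of them restricting to such an extension. -/
lemma exists_mean_right_eq [Finite F] (N : Type*) [AddCommGroup N] [Module ℂ N] (hM : P.W ≤ M) :
    ∃ ρ : GLPair F n → PartialIso F n,
      (∀ x ∈ lifts P P, (ρ x).W = M ∧ x ∈ lifts (ρ x) (ρ x)) ∧
      ∀ φ : PartialIso F n → N,
        mean {A | P.IsTrivialExt A ∧ A.W = M} φ = mean (lifts P P) fun x => φ (ρ x) := by
  have : Nonempty (PartialIso F n) := ⟨P⟩
  choose! ρ hρ hρM hρx using fun (x : GLPair F n) (hx : x ∈ lifts P P) => exists_restrict hx hM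
  have hlift : ∀ x ∈ lifts P P, x ∈ lifts (ρ x) (ρ x) := fun x hx =>
    lifts_subset_lifts_ext (hρ x hx).1 (hρx x hx)
  refine ⟨ρ, fun x hx => ⟨hρM x hx, hlift x hx⟩, fun φ => ?_⟩
  refine mean_eq_mean_of_card_fiber (c := Nat.card (fixer P.W M))
    (show Set.MapsTo ρ (lifts P P) {A | P.IsTrivialExt A ∧ A.W = M} from
      fun x hx => ⟨hρ x hx, hρM x hx⟩) ?_ ?_ φ
  · have : Nonempty (fixer P.W M) := ⟨_, one_mem_fixer _ _⟩
    exact Nat.card_pos.ne'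
  · rintro A ⟨hA, rfl⟩
    rw [← card_lifts hA]
    congr 2
    ext x
    constructor
    · rintro ⟨hx, rfl⟩
      exact hρx x hx
    · intro hx
      have hx' := lifts_subset_lifts_self hA.1 hx
      exact ⟨hx', eq_of_mem_lifts (hlift x hx') (lifts_subset_lifts_ext hA.1 hx) (hρM x hx')⟩

lemma flip_injective : Function.Injective (flip : GLPair F n → GLPair F n) :=
  Function.LeftInverse.injective (g := flip) fun _ => rfl

lemma exists_mean_left_eq [Finite F] (N : Type*) [AddCommGroup N] [Module ℂ N] (hM : P.V ≤ M) :
    ∃ ρ : GLPair F n → PartialIso F n,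
      (∀ x ∈ lifts P P, (ρ x).V = M ∧ x ∈ lifts (ρ x) (ρ x)) ∧
      ∀ φ : PartialIso F n → N,
        mean {A | P.IsTrivialExt A ∧ A.V = M} φ = mean (lifts P P) fun x => φ (ρ x) := by
  obtain ⟨ρ, hρ, hφ⟩ := exists_mean_right_eq (P := P.flip) N hM
  refine ⟨fun x => (ρ x.flip).flip, fun x hx => ?_, fun φ => ?_⟩
  · have := hρ x.flip (flip_mem_lifts.2 hx)
    exact ⟨this.1, flip_mem_lifts.1 this.2⟩
  · have h1 : {A | P.IsTrivialExt A ∧ A.V = M} =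
        PartialIso.flip '' {A | P.flip.IsTrivialExt A ∧ A.W = M} := by
      ext A
      constructor
      · rintro ⟨h, hV⟩
        exact ⟨A.flip, ⟨⟨flip_extends_flip h.1, h.2.2, h.2.1⟩, hV⟩, rfl⟩
      · rintro ⟨A, ⟨h, hV⟩, rfl⟩
        exact ⟨⟨flip_extends_flip h.1, h.2.2, h.2.1⟩, hV⟩
    have h2 : lifts P.flip P.flip = flip '' lifts P P := by
      ext x
      exact ⟨fun h => ⟨x.flip, flip_mem_lifts.1 h, rfl⟩, by
        rintro ⟨x, hx, rfl⟩; exact flip_mem_lifts.2 hx⟩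
    have hinj : Function.Injective (PartialIso.flip : PartialIso F n → PartialIso F n) :=
      Function.LeftInverse.injective (g := PartialIso.flip) fun _ => rfl
    rw [h1, mean_image hinj, hφ, h2, mean_image flip_injective]

lemma mean_lifts_mul_right [Finite F] {a : GLPair F n} (ha : a ∈ fixer P.W P.W)
    (φ : GLPair F n → N) : mean (lifts P P) (fun x => φ (x * a)) = mean (lifts P P) φ := by
  rw [← mean_image (mul_left_injective a)]
  congr 1
  refine Set.eq_of_subset_of_ncard_le ?_ (Set.ncard_image_of_injective _ (mul_left_injective a)).ge
  rintro _ ⟨x, hx, rfl⟩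
  rw [mem_lifts_iff_inv_mul (extends_refl P) hx]
  simpa using ha

lemma mean_lifts_mul_left [Finite F] {b : GLPair F n} (hb : b ∈ fixer P.V P.V)
    (φ : GLPair F n → N) : mean (lifts P P) (fun x => φ (b * x)) = mean (lifts P P) φ := by
  rw [← mean_image (mul_right_injective b)]
  congr 1
  refine Set.eq_of_subset_of_ncard_le ?_ (Set.ncard_image_of_injective _ (mul_right_injective b)).ge
  rintro _ ⟨x, hx, rfl⟩
  rw [mem_lifts_iff_mul_inv (extends_refl P) hx]
  simpa using hb

lemma mean_lifts_compo [Finite F] {A B : PartialIso F n} {y : GLPair F n} (h : A.W = B.V)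
    (hx : x ∈ lifts A A) (hy : y ∈ lifts B B) (φ : GLPair F n → N) :
    mean (lifts (A.compo B h) (A.compo B h)) φ =
      mean (fixer A.W A.W) fun k => φ (x * k * y) := by
  refine Eq.trans ?_
    (mean_image ((mul_left_injective y).comp (mul_right_injective x)) (fixer A.W A.W) φ)
  congr 1
  ext z
  constructor
  · intro hz
    refine ⟨x⁻¹ * z * y⁻¹, ?_, by simp [mul_assoc]⟩
    rw [← mul_mul_mem_lifts_compo h hx hy]
    simpa [mul_assoc] using hz
  · rintro ⟨k, hk, rfl⟩
    exact (mul_mul_mem_lifts_compo h hx hy).2 hk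

lemma _root_.mulBasis_of_eq_top [Finite F] {P Q : PartialIso F n} (hP : P.W = ⊤) (hQ : Q.V = ⊤) :
    mulBasis P Q = Finsupp.single (P.compo Q (hP.trans hQ.symm)) (1 : ℂ) := by
  have h : P.W ⊔ Q.V = ⊤ := by rw [hP, top_sup_eq]
  rw [mulBasis_eq_bilinExt, h, avgL_top, avgR_top_of_eq_top hP,
    avgR_top_of_eq_top (Q.V_eq_top_iff.1 hQ), bilinExt_single, pairTerm,
    dif_pos (hP.trans hQ.symm)]

lemma mulBasis_full [Finite F] (x y : GLPair F n) :
    mulBasis x.full y.full = Finsupp.single (x * y).full (1 : ℂ) :=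
  mulBasis_of_eq_top rfl rfl

lemma _root_.opR_top_mulBasis [Finite F] (P Q : PartialIso F n) :
    opR ⊤ (mulBasis P Q) =
      piMul (opR ⊤ (Finsupp.single P 1)) (opR ⊤ (Finsupp.single Q 1)) := by
  obtain ⟨ρ, hρ, hρφ⟩ := exists_mean_right_eq (P := P) (PIAlg F n)
    (le_sup_left : P.W ≤ P.W ⊔ Q.V)
  obtain ⟨σ, hσ, hσφ⟩ := exists_mean_left_eq (P := Q) (PIAlg F n)
    (le_sup_right : Q.V ≤ P.W ⊔ Q.V)
  rw [mulBasis_eq_bilinExt, avgR_eq_mean, avgL_eq_mean, hρφ, hσφ, bilinExt_mean, map_mean,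
    opR_top_single, opR_top_single, piMul_eq_bilinExt, bilinExt_mean]
  simp only [map_mean, mulBasis_full]
  have h1 : ∀ x ∈ lifts P P, ∀ y ∈ lifts Q Q, opR ⊤ (pairTerm (ρ x) (σ y)) =
      mean (fixer (P.W ⊔ Q.V) (P.W ⊔ Q.V)) fun k =>
        Finsupp.single (x * k * y).full (1 : ℂ) := fun x hx y hy => by
    rw [pairTerm, dif_pos ((hρ x hx).1.trans (hσ y hy).1.symm), opR_top_single,
      mean_lifts_compo _ (hρ x hx).2 (hσ y hy).2, (hρ x hx).1]
  rw [mean_congr fun x hx => mean_congr (h1 x hx)]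
  rw [mean_congr fun x hx => mean_comm _ _ _, mean_comm]
  rw [← mean_const ⟨1, one_mem_fixer (P.W ⊔ Q.V) (P.W ⊔ Q.V)⟩
    (mean (lifts P P) fun x => mean (lifts Q Q) fun y => Finsupp.single (x * y).full (1 : ℂ))]
  refine mean_congr fun k hk => ?_
  obtain ⟨a, ha, b, hb, rfl⟩ := exists_mul_of_mem_fixer_sup hk
  refine Eq.trans (mean_congr fun x _ => ?_) (mean_lifts_mul_right ha fun x =>
    mean (lifts Q Q) fun y => Finsupp.single (x * y).full (1 : ℂ))
  refine Eq.trans (mean_congr fun y _ => ?_) (mean_lifts_mul_left hb fun y =>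
    Finsupp.single (x * a * y).full (1 : ℂ))
  simp only [mul_assoc]

/-- The pair through which `k` and `l` act on one side of a total partial isomorphism. -/
def conj (k : (Fin n → F) ≃ₗ[F] (Fin n → F)) : GLPair F n := (k.symm, MulOpposite.op k)

lemma conj_mul_mul_conj_mem_lifts (k l : (Fin n → F) ≃ₗ[F] (Fin n → F)) (P : PartialIso F n)
    (x : GLPair F n) :
    conj k * x * conj l.symm ∈ lifts (P.act k l) (P.act k l) ↔ x ∈ lifts P P := by
  have hV (v) : v ∈ (P.act k l).V ↔ k v ∈ P.V := Iff.rfl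
  have hW (v) : v ∈ (P.act k l).W ↔ l v ∈ P.W := Iff.rfl
  have hg₁ (v : (P.act k l).V) : ((P.act k l).g₁ v : Fin n → F) = l.symm (P.g₁ ⟨k v, v.2⟩) := rfl
  have hg₂ (v : (P.act k l).W) : ((P.act k l).g₂ v : Fin n → F) = k.symm (P.g₂ ⟨l v, v.2⟩) := rfl
  have hf (v) : (conj k * x * conj l.symm).fwd v = l.symm (x.fwd (k v)) := rfl
  have hb (v) : (conj k * x * conj l.symm).bwd v = k.symm (x.bwd (l v)) := rfl
  refine and_congr ⟨fun h v => ?_, fun h v => ?_⟩ <| and_congr ⟨fun h w => ?_, fun h w => ?_⟩ <|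
    and_congr ?_ ?_
  · simpa [hf, hg₁] using h ⟨k.symm v, by simp [hV]⟩
  · rw [hf, hg₁, ← h]
  · simpa [hb, hg₂] using h ⟨l.symm w, by simp [hW]⟩
  · rw [hb, hg₂, ← h]
  · simp only [hV, hf, hb, map_sub, LinearEquiv.apply_symm_apply]
    exact (k.surjective.forall (p := fun v => x.bwd (x.fwd v) - v ∈ P.V)).symm
  · simp only [hW, hf, hb, map_sub, LinearEquiv.apply_symm_apply]
    exact (l.surjective.forall (p := fun v => x.fwd (x.bwd v) - v ∈ P.W)).symm

lemma act_full (k l : (Fin n → F) ≃ₗ[F] (Fin n → F)) (x : GLPair F n) :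
    x.full.act k l = (conj k * x * conj l.symm).full :=
  (full_eq ((conj_mul_mul_conj_mem_lifts k l _ x).2 (mem_lifts_full x)) rfl).symm

lemma lifts_act (k l : (Fin n → F) ≃ₗ[F] (Fin n → F)) (P : PartialIso F n) :
    lifts (P.act k l) (P.act k l) = (fun x => conj k * x * conj l.symm) '' lifts P P := by
  ext z
  constructor
  · intro hz
    refine ⟨(conj k)⁻¹ * z * (conj l.symm)⁻¹, ?_, by simp [mul_assoc]⟩
    rw [← conj_mul_mul_conj_mem_lifts k l]
    simpa [mul_assoc] using hz
  · rintro ⟨x, hx, rfl⟩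
    exact (conj_mul_mul_conj_mem_lifts k l P x).2 hx

lemma _root_.opR_top_actA [Finite F] (k l : (Fin n → F) ≃ₗ[F] (Fin n → F)) (x : PIAlg F n) :
    opR ⊤ (actA k l x) = actA k l (opR ⊤ x) := by
  change (opR ⊤ ∘ₗ Finsupp.lmapDomain ℂ ℂ (PartialIso.act k l)) x =
    (Finsupp.lmapDomain ℂ ℂ (PartialIso.act k l) ∘ₗ opR ⊤) x
  congr 1
  refine Finsupp.lhom_ext' fun P => LinearMap.ext_ring ?_
  simp only [LinearMap.comp_apply, Finsupp.lsingle_apply, Finsupp.lmapDomain_apply,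
    Finsupp.mapDomain_single, opR_top_single]
  rw [← Finsupp.lmapDomain_apply ℂ ℂ, map_mean, lifts_act]
  refine (mean_image ((mul_left_injective (conj l.symm)).comp (mul_right_injective (conj k)))
    (lifts P P) _).trans ?_
  simp only [Finsupp.lmapDomain_apply, Finsupp.mapDomain_single, act_full, Function.comp_apply]

lemma _root_.opR_top_eq_opL_top : opR (⊤ : Submodule F (Fin n → F)) = opL ⊤ := by
  simp [opR, opL, avgL_top]

lemma _root_.opR_top_piMul [Finite F] (x y : PIAlg F n) :
    opR ⊤ (piMul x y) = piMul (opR ⊤ x) (opR ⊤ y) := by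
  simp only [piMul_eq_bilinExt]
  change ((bilinExt mulBasis).compr₂ (opR ⊤)) x y =
    ((bilinExt mulBasis).compl₁₂ (opR ⊤) (opR ⊤)) x y
  congr 2
  refine Finsupp.lhom_ext' fun P => LinearMap.ext_ring ?_
  refine Finsupp.lhom_ext' fun Q => LinearMap.ext_ring ?_
  simpa [bilinExt_single, piMul_eq_bilinExt] using opR_top_mulBasis P Q

lemma _root_.range_opR_top [Finite F] :
    LinearMap.range (opR (⊤ : Submodule F (Fin n → F))) =
      Submodule.span ℂ (Set.range fun x : GLPair F n => Finsupp.single x.full (1 : ℂ)) := by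
  apply le_antisymm
  · rw [opR, Finsupp.range_linearCombination, Submodule.span_le]
    rintro _ ⟨P, rfl⟩
    simp only [sup_top_eq, avgR_top]
    exact mean_mem fun x _ => Submodule.subset_span ⟨x, rfl⟩
  · rw [Submodule.span_le]
    rintro _ ⟨x, rfl⟩
    refine ⟨Finsupp.single x.full 1, ?_⟩
    rw [opR, Finsupp.linearCombination_single, one_smul, sup_top_eq, avgR_top_of_eq_top rfl]

/-- The identification of `GL(n,F) × GL(n,F)ᵒᵖ` with pairs of automorphisms. -/
noncomputable def ofMatrix (F : Type*) [Field F] (n : ℕ) :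
    Matrix.GeneralLinearGroup (Fin n) F × (Matrix.GeneralLinearGroup (Fin n) F)ᵐᵒᵖ ≃*
      GLPair F n :=
  let e := Matrix.GeneralLinearGroup.toLin.trans
    (LinearMap.GeneralLinearGroup.generalLinearEquiv F (Fin n → F))
  e.prodCongr (MulEquiv.op e)

/-- The embedding of the group algebra of `GL(n,F) × GL(n,F)ᵒᵖ` into `𝒜(n,F)`. -/
noncomputable def ofMonoidAlgebra (F : Type*) [Field F] (n : ℕ) :
    MonoidAlgebra ℂ
      (Matrix.GeneralLinearGroup (Fin n) F × (Matrix.GeneralLinearGroup (Fin n) F)ᵐᵒᵖ)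
      →ₗ[ℂ] PIAlg F n :=
  Finsupp.lmapDomain ℂ ℂ (fun g => (ofMatrix F n g).full) ∘ₗ
    (MonoidAlgebra.coeffLinearEquiv ℂ).toLinearMap

lemma ofMonoidAlgebra_single (g) :
    ofMonoidAlgebra F n (MonoidAlgebra.single g 1) = Finsupp.single (ofMatrix F n g).full 1 :=
  Finsupp.mapDomain_single

lemma ofMonoidAlgebra_injective : Function.Injective (ofMonoidAlgebra F n) :=
  (Finsupp.mapDomain_injective (full_injective.comp (ofMatrix F n).injective)).comp
    (MonoidAlgebra.coeffLinearEquiv ℂ).injective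

lemma range_ofMonoidAlgebra [Finite F] :
    LinearMap.range (ofMonoidAlgebra F n) =
      LinearMap.range (opR (⊤ : Submodule F (Fin n → F))) := by
  rw [ofMonoidAlgebra, LinearMap.range_comp_of_range_eq_top _ (LinearEquiv.range _),
    range_opR_top, Finsupp.range_lmapDomain]
  congr 1
  exact (ofMatrix F n).surjective.range_comp fun x : GLPair F n => Finsupp.single x.full (1 : ℂ)

lemma ofMonoidAlgebra_mul [Finite F] (a b) :
    ofMonoidAlgebra F n (a * b) = piMul (ofMonoidAlgebra F n a) (ofMonoidAlgebra F n b) := by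
  rw [piMul_eq_bilinExt]
  change ((LinearMap.mul ℂ _).compr₂ (ofMonoidAlgebra F n)) a b =
    ((bilinExt mulBasis).compl₁₂ (ofMonoidAlgebra F n) (ofMonoidAlgebra F n)) a b
  congr 2
  refine MonoidAlgebra.lhom_ext' fun g => LinearMap.ext_ring ?_
  refine MonoidAlgebra.lhom_ext' fun h => LinearMap.ext_ring ?_
  simp [MonoidAlgebra.single_mul_single, ofMonoidAlgebra_single, bilinExt_single, mulBasis_full]

end GLPair


/-- `π_n = R^{F^n} = L^{F^n}` is multiplicative; its image is spanned by the partial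
isomorphisms with both subspaces equal to `F^n`, on which the product is
`(g₁,g₂)·(h₁,h₂) = (h₁∘g₁, g₂∘h₂)`, so the image is isomorphic as an algebra to the group
algebra `ℂ[GL(n,F) × GL(n,F)ᵒᵖ]`; moreover `π_n` is equivariant for the two-sided
`GL(n,F)`-action. -/
theorem statement13 {F : Type*} [Field F] [Fintype F] {n : ℕ} :
    opR (⊤ : Submodule F (Fin n → F)) = opL ⊤ ∧
    (∀ x y : PIAlg F n, opR ⊤ (piMul x y) = piMul (opR ⊤ x) (opR ⊤ y)) ∧
    LinearMap.range (opR (⊤ : Submodule F (Fin n → F))) =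
      Submodule.span ℂ {x : PIAlg F n |
        ∃ P : PartialIso F n, P.V = ⊤ ∧ P.W = ⊤ ∧ x = Finsupp.single P 1} ∧
    (∀ (P Q : PartialIso F n) (_ : P.V = ⊤) (hPW : P.W = ⊤) (hQV : Q.V = ⊤) (_ : Q.W = ⊤),
      piMul (Finsupp.single P (1 : ℂ)) (Finsupp.single Q (1 : ℂ)) =
        Finsupp.single (P.compo Q (hPW.trans hQV.symm)) (1 : ℂ)) ∧
    (∃ Φ : MonoidAlgebra ℂ
        (Matrix.GeneralLinearGroup (Fin n) F × (Matrix.GeneralLinearGroup (Fin n) F)ᵐᵒᵖ)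
        →ₗ[ℂ] PIAlg F n,
      Function.Injective Φ ∧
      LinearMap.range Φ = LinearMap.range (opR (⊤ : Submodule F (Fin n → F))) ∧
      ∀ a b, Φ (a * b) = piMul (Φ a) (Φ b)) ∧
    (∀ (k l : (Fin n → F) ≃ₗ[F] (Fin n → F)) (x : PIAlg F n),
      opR ⊤ (actA k l x) = actA k l (opR ⊤ x)) := by
  refine ⟨opR_top_eq_opL_top, opR_top_piMul, ?_, ?_,
    ⟨GLPair.ofMonoidAlgebra F n, GLPair.ofMonoidAlgebra_injective, GLPair.range_ofMonoidAlgebra,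
      GLPair.ofMonoidAlgebra_mul⟩, opR_top_actA⟩
  · rw [range_opR_top]
    congr 1
    ext x
    constructor
    · rintro ⟨z, rfl⟩
      exact ⟨z.full, rfl, rfl, rfl⟩
    · rintro ⟨P, -, hW, rfl⟩
      obtain ⟨z, -, rfl⟩ : P ∈ GLPair.full '' GLPair.lifts P P := by
        rw [GLPair.image_full_lifts]
        exact ⟨P.isTrivialExt_self hW, hW⟩
      exact ⟨z, rfl⟩
  · intro P Q _ hPW hQV _
    rw [piMul_eq_bilinExt, bilinExt_single, mulBasis_of_eq_top hPW hQV]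
end

section
/- Let n ≤ n′ be positive integers, and regard (𝔽_q)^n as the subspace of (𝔽_q)^{n′} spanned by the first n coordinates. Define the linear map φ_n^{n′} : 𝒜(n′, 𝔽_q) → 𝒜(n, 𝔽_q) on basis elements by: φ_n^{n′}(V, W, g₁, g₂) = q^{(n′−n)k} · ( (q⁻¹)_{n′} (q⁻¹)_{n−k} ) / ( (q⁻¹)_{n′−k} (q⁻¹)_n ) · (V, W, g₁, g₂) if V + W ⊆ (𝔽_q)^n, where k = dim V = dim W, and φ_n^{n′}(V, W, g₁, g₂) = 0 otherwise. Then φ_n^{n′} maps 𝒵(n′, 𝔽_q) onto 𝒵(n, 𝔽_q), and its restriction to 𝒵(n′, 𝔽_q) is a homomorphism of algebras: φ_n^{n′}(x * y) = φ_n^{n′}(x) * φ_n^{n′}(y) for all x, y ∈ 𝒵(n′, 𝔽_q), and φ_n^{n′} sends the unit to the unit. -/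
variable {F : Type*} [Field F] {n : ℕ}

open scoped Classical

/-- The inclusion of `F^n` into `F^{n'}` as the span of the first `n` coordinates. -/
def inclMap (F : Type*) [Field F] (n n' : ℕ) : (Fin n → F) →ₗ[F] (Fin n' → F) where
  toFun x i := if h : (i : ℕ) < n then x ⟨i, h⟩ else 0
  map_add' x y := by
    funext i
    by_cases h : (i : ℕ) < n <;> simp [h]
  map_smul' c x := by
    funext i
    by_cases h : (i : ℕ) < n <;> simp [h]

lemma inclMap_injective (F : Type*) [Field F] {n n' : ℕ} (h : n ≤ n') :
    Function.Injective (inclMap F n n') := by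
  intro x y hxy
  funext i
  have h2 := congrFun hxy ⟨(i : ℕ), lt_of_lt_of_le i.isLt h⟩
  simpa [inclMap, i.isLt] using h2

/-- Transport of a subspace contained in the range of an injective linear map. -/
noncomputable def pullIso {F : Type*} [Field F] {M N : Type*} [AddCommGroup M] [Module F M]
    [AddCommGroup N] [Module F N] (ι : M →ₗ[F] N) (hι : Function.Injective ι)
    (p : Submodule F N) (hp : p ≤ LinearMap.range ι) :
    (p.comap ι) ≃ₗ[F] p := by
  refine LinearEquiv.ofBijective (ι.restrict fun x hx => hx) ⟨?_, ?_⟩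
  · intro a b hab
    exact Subtype.ext (hι (congrArg Subtype.val hab))
  · rintro ⟨y, hy⟩
    obtain ⟨x, rfl⟩ := hp hy
    exact ⟨⟨x, hy⟩, rfl⟩

/-- Transport of a partial isomorphism of `F^{n'}` whose subspaces lie in the image of
`F^n` to a partial isomorphism of `F^n`. -/
noncomputable def pullPI {F : Type*} [Field F] {n n' : ℕ}
    (ι : (Fin n → F) →ₗ[F] (Fin n' → F)) (hι : Function.Injective ι) (P : PartialIso F n')
    (hV : P.V ≤ LinearMap.range ι) (hW : P.W ≤ LinearMap.range ι) : PartialIso F n where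
  V := P.V.comap ι
  W := P.W.comap ι
  g₁ := ((pullIso ι hι P.V hV).trans P.g₁).trans (pullIso ι hι P.W hW).symm
  g₂ := ((pullIso ι hι P.W hW).trans P.g₂).trans (pullIso ι hι P.V hV).symm

/-- The projection `φ_n^{n'} : 𝒜(n',F) → 𝒜(n,F)`: a basis element `(V,W,g₁,g₂)` with
`V + W ⊆ F^n` is sent to `q^{(n'-n)k} (q⁻¹)_{n'} (q⁻¹)_{n-k} / ((q⁻¹)_{n'-k} (q⁻¹)_n)`
times itself (with `k = dim V`), and to `0` otherwise. -/
noncomputable def phiMap {F : Type*} [Field F] [Fintype F] {n n' : ℕ} (hnn : n ≤ n')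
    (x : PIAlg F n') : PIAlg F n :=
  x.sum fun P c =>
    if h : P.V ⊔ P.W ≤ LinearMap.range (inclMap F n n') then
      Finsupp.single
        (pullPI (inclMap F n n') (inclMap_injective F hnn) P
          (le_trans le_sup_left h) (le_trans le_sup_right h))
        ((((Fintype.card F : ℚ) ^ ((n' - n) * Module.finrank F P.V) *
            (qPoch (Fintype.card F) n' * qPoch (Fintype.card F) (n - Module.finrank F P.V)) /
            (qPoch (Fintype.card F) (n' - Module.finrank F P.V) *
              qPoch (Fintype.card F) n) : ℚ) : ℂ) * c)
    else 0

section Helpers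

namespace PartialIso

/-- The graph of `g₁`. -/
def R₁ (P : PartialIso F n) (v w : Fin n → F) : Prop :=
  ∃ h : v ∈ P.V, (P.g₁ ⟨v, h⟩ : Fin n → F) = w

/-- The graph of `g₂`. -/
def R₂ (P : PartialIso F n) (w v : Fin n → F) : Prop :=
  ∃ h : w ∈ P.W, (P.g₂ ⟨w, h⟩ : Fin n → F) = v

/-- The partial isomorphism obtained by exchanging the left and right sides. -/
def swap (P : PartialIso F n) : PartialIso F n := ⟨P.W, P.V, P.g₂, P.g₁⟩

lemma R₁.mem_left {P : PartialIso F n} {v w} (h : P.R₁ v w) : v ∈ P.V := h.1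

lemma R₁.mem_right {P : PartialIso F n} {v w} (h : P.R₁ v w) : w ∈ P.W := by
  obtain ⟨h, rfl⟩ := h
  exact (P.g₁ ⟨v, h⟩).2

lemma R₂.mem_left {P : PartialIso F n} {v w} (h : P.R₂ w v) : w ∈ P.W := h.1

lemma R₂.mem_right {P : PartialIso F n} {v w} (h : P.R₂ w v) : v ∈ P.V :=
  R₁.mem_right (P := P.swap) h

lemma R₁.right_unique {P : PartialIso F n} {v w w'} (h : P.R₁ v w) (h' : P.R₁ v w') :
    w = w' := by
  obtain ⟨_, rfl⟩ := h
  obtain ⟨_, rfl⟩ := h'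
  rfl

lemma R₂.right_unique {P : PartialIso F n} {v v' w} (h : P.R₂ w v) (h' : P.R₂ w v') :
    v = v' :=
  R₁.right_unique (P := P.swap) h h'

lemma exists_R₁ (P : PartialIso F n) {v} (h : v ∈ P.V) : ∃ w, P.R₁ v w := ⟨_, h, rfl⟩

lemma exists_R₂ (P : PartialIso F n) {w} (h : w ∈ P.W) : ∃ v, P.R₂ w v := ⟨_, h, rfl⟩

lemma ext_rel {P Q : PartialIso F n} (h₁ : ∀ v w, P.R₁ v w ↔ Q.R₁ v w)
    (h₂ : ∀ w v, P.R₂ w v ↔ Q.R₂ w v) : P = Q := by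
  have hV : P.V = Q.V := by
    ext v
    exact ⟨fun h => ((h₁ _ _).1 (P.exists_R₁ h).choose_spec).mem_left,
      fun h => ((h₁ _ _).2 (Q.exists_R₁ h).choose_spec).mem_left⟩
  have hW : P.W = Q.W := by
    ext v
    exact ⟨fun h => ((h₂ _ _).1 (P.exists_R₂ h).choose_spec).mem_left,
      fun h => ((h₂ _ _).2 (Q.exists_R₂ h).choose_spec).mem_left⟩
  obtain ⟨V, W, g₁, g₂⟩ := P
  obtain ⟨V', W', g₁', g₂'⟩ := Q
  obtain rfl : V = V' := hV
  obtain rfl : W = W' := hW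
  congr 1
  · ext v
    have := (h₁ v (g₁ v)).1 ⟨v.2, rfl⟩
    exact congrFun this.choose_spec.symm _
  · ext v
    have := (h₂ v (g₂ v)).1 ⟨v.2, rfl⟩
    exact congrFun this.choose_spec.symm _

instance [Finite F] : Finite (PartialIso F n) := by
  refine Finite.of_injective (fun P : PartialIso F n => (P.R₁, P.R₂)) fun P Q h => ?_
  simp only [Prod.mk.injEq] at h
  exact ext_rel (fun v w => by rw [h.1]) (fun v w => by rw [h.2])

noncomputable instance [Finite F] : Fintype (PartialIso F n) := Fintype.ofFinite _

lemma extends_iff {P Q : PartialIso F n} :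
    Q.Extends P ↔ (∀ v w, P.R₁ v w → Q.R₁ v w) ∧ (∀ w v, P.R₂ w v → Q.R₂ w v) := by
  constructor
  · rintro ⟨hV, hW, h₁, h₂⟩
    refine ⟨?_, ?_⟩
    · rintro v w ⟨hv, rfl⟩
      exact ⟨hV hv, h₁ ⟨v, hv⟩⟩
    · rintro v w ⟨hv, rfl⟩
      exact ⟨hW hv, h₂ ⟨v, hv⟩⟩
  · rintro ⟨h₁, h₂⟩
    exact ⟨fun v hv => (h₁ v _ ⟨hv, rfl⟩).1, fun v hv => (h₂ v _ ⟨hv, rfl⟩).1,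
      fun v => (h₁ v _ ⟨v.2, rfl⟩).2, fun v => (h₂ v _ ⟨v.2, rfl⟩).2⟩

lemma isTrivialExt_iff {P Q : PartialIso F n} :
    P.IsTrivialExt Q ↔ ((∀ v w, P.R₁ v w → Q.R₁ v w) ∧ (∀ w v, P.R₂ w v → Q.R₂ w v)) ∧
      (∀ v w v', Q.R₁ v w → Q.R₂ w v' → v' - v ∈ P.V) ∧
      (∀ w v w', Q.R₂ w v → Q.R₁ v w' → w' - w ∈ P.W) := by
  rw [IsTrivialExt, extends_iff]
  refine and_congr_right fun _ => and_congr ⟨?_, ?_⟩ ⟨?_, ?_⟩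
  · rintro h v w v' ⟨hv, rfl⟩ ⟨_, rfl⟩
    exact h ⟨v, hv⟩
  · intro h v
    exact h v _ _ ⟨v.2, rfl⟩ ⟨(Q.g₁ v).2, rfl⟩
  · rintro h v w v' ⟨hv, rfl⟩ ⟨_, rfl⟩
    exact h ⟨v, hv⟩
  · intro h v
    exact h v _ _ ⟨v.2, rfl⟩ ⟨(Q.g₂ v).2, rfl⟩

lemma IsTrivialExt.le_V {P Q : PartialIso F n} (h : P.IsTrivialExt Q) : P.V ≤ Q.V := h.1.1

lemma IsTrivialExt.le_W {P Q : PartialIso F n} (h : P.IsTrivialExt Q) : P.W ≤ Q.W := h.1.2.1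

lemma isTrivialExt_swap {P Q : PartialIso F n} :
    P.swap.IsTrivialExt Q.swap ↔ P.IsTrivialExt Q := by
  rw [isTrivialExt_iff, isTrivialExt_iff]
  exact and_congr and_comm and_comm

/-- `R` is the composition of `A` and `B`. -/
def IsComp (A B R : PartialIso F n) : Prop :=
  A.W = B.V ∧ (∀ v w, R.R₁ v w ↔ ∃ m, A.R₁ v m ∧ B.R₁ m w) ∧
    (∀ w v, R.R₂ w v ↔ ∃ m, B.R₂ w m ∧ A.R₂ m v)

lemma compo_R₁ {A B : PartialIso F n} (h : A.W = B.V) (v w : Fin n → F) :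
    (A.compo B h).R₁ v w ↔ ∃ m, A.R₁ v m ∧ B.R₁ m w := by
  constructor
  · rintro ⟨hv, rfl⟩
    exact ⟨A.g₁ ⟨v, hv⟩, ⟨hv, rfl⟩, ⟨h ▸ (A.g₁ ⟨v, hv⟩).2, rfl⟩⟩
  · rintro ⟨m, ⟨hv, rfl⟩, ⟨hm, rfl⟩⟩
    exact ⟨hv, rfl⟩

lemma compo_R₂ {A B : PartialIso F n} (h : A.W = B.V) (w v : Fin n → F) :
    (A.compo B h).R₂ w v ↔ ∃ m, B.R₂ w m ∧ A.R₂ m v :=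
  compo_R₁ (A := B.swap) (B := A.swap) h.symm w v

lemma isComp_iff {A B R : PartialIso F n} : IsComp A B R ↔ ∃ h, A.compo B h = R := by
  constructor
  · rintro ⟨h, h₁, h₂⟩
    exact ⟨h, ext_rel (fun v w => (compo_R₁ h v w).trans (h₁ v w).symm)
      (fun v w => (compo_R₂ h v w).trans (h₂ v w).symm)⟩
  · rintro ⟨h, rfl⟩
    exact ⟨h, compo_R₁ h, compo_R₂ h⟩

lemma IsComp.V_eq {A B R : PartialIso F n} (h : IsComp A B R) : A.V = R.V := by
  obtain ⟨h, rfl⟩ := isComp_iff.1 h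
  rfl

lemma IsComp.W_eq {A B R : PartialIso F n} (h : IsComp A B R) : B.W = R.W := by
  obtain ⟨h, rfl⟩ := isComp_iff.1 h
  rfl

section Act

variable (k l : (Fin n → F) ≃ₗ[F] (Fin n → F)) (P : PartialIso F n)

lemma mem_act_V {v : Fin n → F} : v ∈ (P.act k l).V ↔ k v ∈ P.V := Iff.rfl

lemma mem_act_W {v : Fin n → F} : v ∈ (P.act k l).W ↔ l v ∈ P.W := Iff.rfl

lemma act_R₁ {v w : Fin n → F} : (P.act k l).R₁ v w ↔ P.R₁ (k v) (l w) := by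
  have key : ∀ h : v ∈ (P.act k l).V, l ((P.act k l).g₁ ⟨v, h⟩ : Fin n → F) =
      P.g₁ ⟨k v, h⟩ := by
    intro h
    have := LinearEquiv.apply_symm_apply ((l.submoduleMap (P.W.comap
      (l : (Fin n → F) →ₗ[F] (Fin n → F)))).trans (LinearEquiv.ofEq _ _ (map_comap_equiv l P.W)))
      (P.g₁ ⟨k v, h⟩)
    exact congrArg Subtype.val this
  constructor
  · rintro ⟨h, rfl⟩
    exact ⟨h, (key h).symm⟩
  · rintro ⟨h, hw⟩
    exact ⟨h, l.injective ((key h).trans hw)⟩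

lemma act_R₂ {v w : Fin n → F} : (P.act k l).R₂ w v ↔ P.R₂ (l w) (k v) :=
  act_R₁ l k P.swap

lemma act_symm_act : (P.act k l).act k.symm l.symm = P :=
  ext_rel (fun v w => by simp [act_R₁]) (fun v w => by simp [act_R₂])

lemma act_act_symm : (P.act k.symm l.symm).act k l = P :=
  ext_rel (fun v w => by simp [act_R₁]) (fun v w => by simp [act_R₂])

/-- The two-sided action as a permutation. -/
noncomputable def actEquiv : PartialIso F n ≃ PartialIso F n where
  toFun := act k l
  invFun := act k.symm l.symm
  left_inv := act_symm_act k l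
  right_inv := act_act_symm k l

end Act

section Push

variable {n' : ℕ} (ι : (Fin n → F) →ₗ[F] (Fin n' → F)) (hι : Function.Injective ι)

/-- The image of a partial isomorphism under an injective linear map. -/
noncomputable def push (P : PartialIso F n) : PartialIso F n' where
  V := P.V.map ι
  W := P.W.map ι
  g₁ := ((Submodule.equivMapOfInjective ι hι P.V).symm.trans P.g₁).trans
    (Submodule.equivMapOfInjective ι hι P.W)
  g₂ := ((Submodule.equivMapOfInjective ι hι P.W).symm.trans P.g₂).trans
    (Submodule.equivMapOfInjective ι hι P.V)

variable {ι}

lemma push_R₁ (P : PartialIso F n) (v w) :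
    (P.push ι hι).R₁ v w ↔ ∃ v' w', ι v' = v ∧ ι w' = w ∧ P.R₁ v' w' := by
  have key : ∀ (v : Fin n → F) (h : v ∈ P.V),
      ((P.push ι hι).g₁ ⟨ι v, Submodule.mem_map_of_mem h⟩ : Fin n' → F) =
        ι (P.g₁ ⟨v, h⟩) := by
    intro v h
    have : (Submodule.equivMapOfInjective ι hι P.V).symm ⟨ι v, Submodule.mem_map_of_mem h⟩ =
        ⟨v, h⟩ := by
      rw [LinearEquiv.symm_apply_eq]; rfl
    change ((Submodule.equivMapOfInjective ι hι P.W) (P.g₁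
      ((Submodule.equivMapOfInjective ι hι P.V).symm ⟨ι v, Submodule.mem_map_of_mem h⟩)) :
        Fin n' → F) = _
    rw [this]
    rfl
  constructor
  · rintro ⟨h, rfl⟩
    obtain ⟨v, hv, rfl⟩ := h
    exact ⟨v, _, rfl, (key v hv).symm, hv, rfl⟩
  · rintro ⟨v, w, rfl, rfl, h, rfl⟩
    exact ⟨_, key v h⟩

lemma push_R₂ (P : PartialIso F n) (w v) :
    (P.push ι hι).R₂ w v ↔ ∃ w' v', ι w' = w ∧ ι v' = v ∧ P.R₂ w' v' :=
  push_R₁ hι P.swap w v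

lemma push_R₁_apply (P : PartialIso F n) (v w) : (P.push ι hι).R₁ (ι v) (ι w) ↔ P.R₁ v w := by
  rw [push_R₁]
  constructor
  · rintro ⟨v', w', hv, hw, h⟩
    rwa [← hι hv, ← hι hw]
  · exact fun h => ⟨v, w, rfl, rfl, h⟩

lemma push_R₂_apply (P : PartialIso F n) (w v) : (P.push ι hι).R₂ (ι w) (ι v) ↔ P.R₂ w v :=
  push_R₁_apply hι P.swap w v

lemma pull_R₁ (P : PartialIso F n') (hV : P.V ≤ LinearMap.range ι) (hW : P.W ≤ LinearMap.range ι)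
    (v w) : (pullPI ι hι P hV hW).R₁ v w ↔ P.R₁ (ι v) (ι w) := by
  have key : ∀ h : v ∈ (pullPI ι hι P hV hW).V,
      ι ((pullPI ι hι P hV hW).g₁ ⟨v, h⟩ : Fin n → F) = P.g₁ ⟨ι v, h⟩ := by
    intro h
    exact congrArg Subtype.val (LinearEquiv.apply_symm_apply (pullIso ι hι P.W hW) (P.g₁ ⟨ι v, h⟩))
  constructor
  · rintro ⟨h, rfl⟩
    exact ⟨h, (key h).symm⟩
  · rintro ⟨h, hw⟩
    exact ⟨h, hι ((key h).trans hw)⟩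

lemma pull_R₂ (P : PartialIso F n') (hV : P.V ≤ LinearMap.range ι) (hW : P.W ≤ LinearMap.range ι)
    (w v) : (pullPI ι hι P hV hW).R₂ w v ↔ P.R₂ (ι w) (ι v) :=
  pull_R₁ hι P.swap hW hV w v

lemma pull_push (P : PartialIso F n) (hV) (hW) : pullPI ι hι (P.push ι hι) hV hW = P :=
  ext_rel (fun v w => by rw [pull_R₁, push_R₁_apply]) (fun v w => by rw [pull_R₂, push_R₂_apply])

lemma push_pull (P : PartialIso F n') (hV : P.V ≤ LinearMap.range ι)
    (hW : P.W ≤ LinearMap.range ι) : (pullPI ι hι P hV hW).push ι hι = P := by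
  refine ext_rel (fun v w => ?_) (fun w v => ?_)
  · rw [push_R₁]
    constructor
    · rintro ⟨v, w, rfl, rfl, h⟩
      exact (pull_R₁ ..).1 h
    · intro h
      obtain ⟨v, rfl⟩ := hV h.mem_left
      obtain ⟨w, rfl⟩ := hW h.mem_right
      exact ⟨v, w, rfl, rfl, (pull_R₁ ..).2 h⟩
  · rw [push_R₂]
    constructor
    · rintro ⟨v, w, rfl, rfl, h⟩
      exact (pull_R₂ ..).1 h
    · intro h
      obtain ⟨v, rfl⟩ := hW h.mem_left
      obtain ⟨w, rfl⟩ := hV h.mem_right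
      exact ⟨v, w, rfl, rfl, (pull_R₂ ..).2 h⟩

lemma push_injective : Function.Injective (push (F := F) ι hι) := by
  intro P Q h
  exact ext_rel (fun v w => by rw [← push_R₁_apply hι, h, push_R₁_apply])
    (fun v w => by rw [← push_R₂_apply hι, h, push_R₂_apply])

lemma push_V_le (P : PartialIso F n) : (P.push ι hι).V ≤ LinearMap.range ι :=
  LinearMap.map_le_range

lemma push_W_le (P : PartialIso F n) : (P.push ι hι).W ≤ LinearMap.range ι :=
  LinearMap.map_le_range

lemma finrank_push_V (P : PartialIso F n) :
    Module.finrank F (P.push ι hι).V = Module.finrank F P.V :=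
  (Submodule.equivMapOfInjective ι hι P.V).finrank_eq.symm

lemma push_isTrivialExt {P Q : PartialIso F n} :
    (P.push ι hι).IsTrivialExt (Q.push ι hι) ↔ P.IsTrivialExt Q := by
  rw [isTrivialExt_iff, isTrivialExt_iff]
  refine and_congr (and_congr ⟨?_, ?_⟩ ⟨?_, ?_⟩) (and_congr ⟨?_, ?_⟩ ⟨?_, ?_⟩)
  · intro h v w hvw
    exact (push_R₁_apply hι _ _ _).1 (h _ _ ((push_R₁_apply hι _ _ _).2 hvw))
  · intro h v w hvw
    obtain ⟨v, w, rfl, rfl, hvw'⟩ := (push_R₁ hι _ _ _).1 hvw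
    exact (push_R₁_apply hι _ _ _).2 (h _ _ hvw')
  · intro h v w hvw
    exact (push_R₂_apply hι _ _ _).1 (h _ _ ((push_R₂_apply hι _ _ _).2 hvw))
  · intro h v w hvw
    obtain ⟨v, w, rfl, rfl, hvw'⟩ := (push_R₂ hι _ _ _).1 hvw
    exact (push_R₂_apply hι _ _ _).2 (h _ _ hvw')
  · intro h v w v' h₁ h₂
    obtain ⟨u, hu, huv⟩ := h _ _ _ ((push_R₁_apply hι _ _ _).2 h₁) ((push_R₂_apply hι _ _ _).2 h₂)
    rw [← map_sub] at huv
    exact hι huv ▸ hu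
  · intro h v w v' h₁ h₂
    obtain ⟨v, w, rfl, rfl, h₃⟩ := (push_R₁ hι _ _ _).1 h₁
    obtain ⟨w', v', hw, rfl, h₄⟩ := (push_R₂ hι _ _ _).1 h₂
    obtain rfl := hι hw
    rw [← map_sub]
    exact Submodule.mem_map_of_mem (h _ _ _ h₃ h₄)
  · intro h v w v' h₁ h₂
    obtain ⟨u, hu, huv⟩ := h _ _ _ ((push_R₂_apply hι _ _ _).2 h₁) ((push_R₁_apply hι _ _ _).2 h₂)
    rw [← map_sub] at huv
    exact hι huv ▸ hu
  · intro h v w v' h₁ h₂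
    obtain ⟨v, w, rfl, rfl, h₃⟩ := (push_R₂ hι _ _ _).1 h₁
    obtain ⟨w', v', hw, rfl, h₄⟩ := (push_R₁ hι _ _ _).1 h₂
    obtain rfl := hι hw
    rw [← map_sub]
    exact Submodule.mem_map_of_mem (h _ _ _ h₃ h₄)

lemma push_compo (A B : PartialIso F n) (h : A.W = B.V)
    (h' : (A.push ι hι).W = (B.push ι hι).V) :
    (A.push ι hι).compo (B.push ι hι) h' = (A.compo B h).push ι hι := by
  refine ext_rel (fun v w => ?_) (fun w v => ?_)
  · rw [compo_R₁, push_R₁]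
    constructor
    · rintro ⟨m, h₁, h₂⟩
      obtain ⟨v, w, rfl, rfl, h₃⟩ := (push_R₁ hι _ _ _).1 h₁
      obtain ⟨w', v', hw, rfl, h₄⟩ := (push_R₁ hι _ _ _).1 h₂
      obtain rfl := hι hw
      exact ⟨v, v', rfl, rfl, (compo_R₁ h _ _).2 ⟨_, h₃, h₄⟩⟩
    · rintro ⟨v, w, rfl, rfl, h₁⟩
      obtain ⟨m, h₁, h₂⟩ := (compo_R₁ h _ _).1 h₁
      exact ⟨ι m, (push_R₁_apply hι _ _ _).2 h₁, (push_R₁_apply hι _ _ _).2 h₂⟩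
  · rw [compo_R₂, push_R₂]
    constructor
    · rintro ⟨m, h₁, h₂⟩
      obtain ⟨v, w, rfl, rfl, h₃⟩ := (push_R₂ hι _ _ _).1 h₁
      obtain ⟨w', v', hw, rfl, h₄⟩ := (push_R₂ hι _ _ _).1 h₂
      obtain rfl := hι hw
      exact ⟨v, v', rfl, rfl, (compo_R₂ h _ _).2 ⟨_, h₃, h₄⟩⟩
    · rintro ⟨v, w, rfl, rfl, h₁⟩
      obtain ⟨m, h₁, h₂⟩ := (compo_R₂ h _ _).1 h₁
      exact ⟨ι m, (push_R₂_apply hι _ _ _).2 h₁, (push_R₂_apply hι _ _ _).2 h₂⟩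

lemma push_isComp {A B R : PartialIso F n} :
    IsComp (A.push ι hι) (B.push ι hι) (R.push ι hι) ↔ IsComp A B R := by
  rw [isComp_iff, isComp_iff]
  constructor
  · rintro ⟨h', h⟩
    have hAB : A.W = B.V := Submodule.map_injective_of_injective hι h'
    rw [push_compo hι A B hAB] at h
    exact ⟨hAB, push_injective hι h⟩
  · rintro ⟨h, rfl⟩
    exact ⟨congrArg (Submodule.map ι) h, push_compo hι A B h _⟩

end Push

end PartialIso

end Helpers

section Counting

/-- The number of linear injections from `F^k` to `F^N`. -/
noncomputable def injNum (F : Type*) [Field F] (k N : ℕ) : ℕ :=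
  Nat.card {f : (Fin k → F) →ₗ[F] (Fin N → F) // Function.Injective f}

lemma natCard_injective (X : Type*) [AddCommGroup X] [Module F X] [FiniteDimensional F X]
    {k N : ℕ} (hX : Module.finrank F X = k) :
    Nat.card {f : X →ₗ[F] (Fin N → F) // Function.Injective f} = injNum F k N := by
  have e : X ≃ₗ[F] (Fin k → F) := LinearEquiv.ofFinrankEq _ _ (by simp [hX])
  refine Nat.card_congr ((e.arrowCongr (LinearEquiv.refl F _)).toEquiv.subtypeEquiv fun f => ?_)
  exact (EquivLike.injective_comp e.symm f).symm

lemma exists_linearEquiv_comp_eq {X : Type*} [AddCommGroup X] [Module F X]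
    {N : ℕ} (f g : X →ₗ[F] (Fin N → F)) (hf : Function.Injective f) (hg : Function.Injective g) :
    ∃ e : (Fin N → F) ≃ₗ[F] (Fin N → F), ∀ x, e (f x) = g x := by
  obtain ⟨e, he⟩ := Submodule.exists_linearEquiv_restrict_eq
    ((LinearEquiv.ofInjective f hf).symm.trans (LinearEquiv.ofInjective g hg))
  refine ⟨e, fun x => ?_⟩
  rw [← LinearEquiv.ofInjective_apply f (h := hf) x, ← he]
  simp

lemma natCard_extension_mul {N : ℕ} {A M : Submodule F (Fin N → F)} (hAM : A ≤ M)
    (g : A →ₗ[F] (Fin N → F)) (hg : Function.Injective g) :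
    Nat.card {f : M →ₗ[F] (Fin N → F) // Function.Injective f ∧
        f ∘ₗ Submodule.inclusion hAM = g} * injNum F (Module.finrank F A) N =
      injNum F (Module.finrank F M) N := by
  let T (g : A →ₗ[F] (Fin N → F)) := {f : M →ₗ[F] (Fin N → F) // Function.Injective f ∧
        f ∘ₗ Submodule.inclusion hAM = g}
  have e (g' : {g : A →ₗ[F] (Fin N → F) // Function.Injective g}) : T g' ≃ T g := by
    let a := (exists_linearEquiv_comp_eq g' g g'.2 hg).choose
    have ha : ∀ x, a (g'.1 x) = g x := (exists_linearEquiv_comp_eq g' g g'.2 hg).choose_spec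
    refine ((LinearEquiv.refl F M).arrowCongr a).toEquiv.subtypeEquiv fun f => and_congr ?_ ?_
    · exact (EquivLike.comp_injective f a).symm
    · rw [LinearMap.ext_iff, LinearMap.ext_iff]
      refine forall_congr' fun x => ?_
      rw [← ha]
      exact (a.injective.eq_iff).symm
  have e' : {f : M →ₗ[F] (Fin N → F) // Function.Injective f} ≃
      Σ g' : {g : A →ₗ[F] (Fin N → F) // Function.Injective g}, T g' :=
    { toFun := fun f => ⟨⟨f.1 ∘ₗ Submodule.inclusion hAM,
          f.2.comp (Submodule.inclusion_injective hAM)⟩, ⟨f.1, f.2, rfl⟩⟩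
      invFun := fun f => ⟨f.2.1, f.2.2.1⟩
      left_inv := fun f => rfl
      right_inv := by
        rintro ⟨⟨g, hg⟩, ⟨f, hf, h⟩⟩
        change _ = g at h
        subst h
        rfl }
  rw [← natCard_injective (F := F) M rfl, ← natCard_injective (F := F) A rfl, Nat.card_congr e',
    Nat.card_congr (Equiv.sigmaCongrRight e), Nat.card_congr (Equiv.sigmaEquivProd _ _),
    Nat.card_prod, mul_comm]

/-- The injections from `F^k` to `F^N` are counted by their ranges. -/
lemma injNum_eq_card_mul (k N : ℕ) :
    injNum F k N = Nat.card {M : Submodule F (Fin N → F) // Module.finrank F M = k} *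
      Nat.card ((Fin k → F) ≃ₗ[F] (Fin k → F)) := by
  let b (p : Σ M : {M : Submodule F (Fin N → F) // Module.finrank F M = k},
      ((Fin k → F) ≃ₗ[F] M)) : {f : (Fin k → F) →ₗ[F] (Fin N → F) // Function.Injective f} :=
    ⟨p.1.1.subtype ∘ₗ p.2.toLinearMap, p.1.1.injective_subtype.comp p.2.injective⟩
  have hb : Function.Bijective b := by
    constructor
    · rintro ⟨⟨M, hM⟩, e⟩ ⟨⟨M', hM'⟩, e'⟩ h
      have h : M.subtype ∘ₗ e.toLinearMap = M'.subtype ∘ₗ e'.toLinearMap :=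
        congrArg Subtype.val h
      have hMM : M = M' := by
        simpa [LinearMap.range_comp] using congrArg LinearMap.range h
      subst hMM
      obtain rfl : e = e' :=
        LinearEquiv.ext fun x => Subtype.ext (LinearMap.congr_fun h x)
      rfl
    · intro f
      exact ⟨⟨⟨LinearMap.range f.1, by simp [LinearMap.finrank_range_of_inj f.2]⟩,
        LinearEquiv.ofInjective f.1 f.2⟩, rfl⟩
  have e' (M : {M : Submodule F (Fin N → F) // Module.finrank F M = k}) :
      ((Fin k → F) ≃ₗ[F] M) ≃ ((Fin k → F) ≃ₗ[F] (Fin k → F)) := by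
    have a : M ≃ₗ[F] (Fin k → F) := LinearEquiv.ofFinrankEq _ _ (by simp [M.2])
    exact ⟨fun g => g.trans a, fun g => g.trans a.symm, fun g => by ext1; simp,
      fun g => by ext1; simp⟩
  rw [injNum, ← Nat.card_eq_of_bijective b hb, Nat.card_congr (Equiv.sigmaCongrRight e'),
    Nat.card_congr (Equiv.sigmaEquivProd _ _), Nat.card_prod]

namespace PartialIso

lemma natCard_trivialExt_W {P : PartialIso F n} {M : Submodule F (Fin n → F)} (hM : P.W ≤ M) :
    Nat.card {Q : PartialIso F n // P.IsTrivialExt Q ∧ Q.W = M} =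
      Nat.card {f : M →ₗ[F] (Fin n → F) // Function.Injective f ∧
        f ∘ₗ Submodule.inclusion hM = P.V.subtype ∘ₗ P.g₂.toLinearMap} *
      Nat.card {τ : M →ₗ[F] M //
        (∀ a, (τ (Submodule.inclusion hM a) : Fin n → F) = (P.g₂.trans P.g₁).toLinearMap a) ∧
        ∀ m, (τ m - m : Fin n → F) ∈ P.W} := by
  rw [← Nat.card_prod]
  symm
  have hτ (τ : {τ : M →ₗ[F] M //
        (∀ a, (τ (Submodule.inclusion hM a) : Fin n → F) = (P.g₂.trans P.g₁).toLinearMap a) ∧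
        ∀ m, (τ m - m : Fin n → F) ∈ P.W}) : Function.Injective τ.1 := by
    refine (injective_iff_map_eq_zero _).2 fun m hm => ?_
    have hmW : (m : Fin n → F) ∈ P.W := by
      have := τ.2.2 m
      simpa [hm] using this
    have := τ.2.1 ⟨m, hmW⟩
    change (τ.1 m : Fin n → F) = _ at this
    rw [hm] at this
    have h0 : (P.g₂.trans P.g₁) ⟨m, hmW⟩ = 0 := Subtype.ext this.symm
    rw [LinearEquiv.map_eq_zero_iff] at h0
    have h0 := congrArg Subtype.val h0
    exact Subtype.ext h0
  let build (f : {f : M →ₗ[F] (Fin n → F) // Function.Injective f ∧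
        f ∘ₗ Submodule.inclusion hM = P.V.subtype ∘ₗ P.g₂.toLinearMap})
      (τ : {τ : M →ₗ[F] M //
        (∀ a, (τ (Submodule.inclusion hM a) : Fin n → F) = (P.g₂.trans P.g₁).toLinearMap a) ∧
        ∀ m, (τ m - m : Fin n → F) ∈ P.W}) : PartialIso F n :=
    { V := LinearMap.range f.1
      W := M
      g₁ := (LinearEquiv.ofInjective f.1 f.2.1).symm.trans
        (LinearEquiv.ofInjectiveEndo τ.1 (hτ τ))
      g₂ := LinearEquiv.ofInjective f.1 f.2.1 }
  have build₁ (f τ v w) : (build f τ).R₁ v w ↔ ∃ m : M, f.1 m = v ∧ (τ.1 m : Fin n → F) = w := by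
    constructor
    · rintro ⟨⟨m, rfl⟩, rfl⟩
      refine ⟨m, rfl, ?_⟩
      change _ = ((LinearEquiv.ofInjectiveEndo τ.1 (hτ τ))
        ((LinearEquiv.ofInjective f.1 f.2.1).symm (LinearEquiv.ofInjective f.1 f.2.1 m)) :
          Fin n → F)
      rw [LinearEquiv.symm_apply_apply]
      rfl
    · rintro ⟨m, rfl, rfl⟩
      refine ⟨⟨m, rfl⟩, ?_⟩
      change ((LinearEquiv.ofInjectiveEndo τ.1 (hτ τ))
        ((LinearEquiv.ofInjective f.1 f.2.1).symm (LinearEquiv.ofInjective f.1 f.2.1 m)) :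
          Fin n → F) = _
      rw [LinearEquiv.symm_apply_apply]
      rfl
  have build₂ (f τ w v) : (build f τ).R₂ w v ↔ ∃ m : M, (m : Fin n → F) = w ∧ f.1 m = v := by
    constructor
    · rintro ⟨h, rfl⟩
      exact ⟨⟨w, h⟩, rfl, rfl⟩
    · rintro ⟨m, rfl, rfl⟩
      exact ⟨m.2, rfl⟩
  have hfP (f : {f : M →ₗ[F] (Fin n → F) // Function.Injective f ∧
        f ∘ₗ Submodule.inclusion hM = P.V.subtype ∘ₗ P.g₂.toLinearMap}) (a : P.W) :
      f.1 (Submodule.inclusion hM a) = P.g₂ a := LinearMap.congr_fun f.2.2 a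
  refine Nat.card_eq_of_bijective (fun p => ⟨build p.1 p.2, ?_, rfl⟩) ⟨?_, ?_⟩
  · obtain ⟨f, τ⟩ := p
    refine isTrivialExt_iff.2 ⟨⟨?_, ?_⟩, ?_, ?_⟩
    · rintro v w ⟨hv, rfl⟩
      refine (build₁ _ _ _ _).2 ⟨Submodule.inclusion hM (P.g₂.symm ⟨v, hv⟩), ?_, ?_⟩
      · simp [hfP]
      · simp [τ.2.1]
    · rintro w v ⟨hv, rfl⟩
      exact (build₂ _ _ _ _).2 ⟨_, rfl, hfP f ⟨w, hv⟩⟩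
    · intro v w v' h₁ h₂
      obtain ⟨m, rfl, rfl⟩ := (build₁ _ _ _ _).1 h₁
      obtain ⟨m', hm', rfl⟩ := (build₂ _ _ _ _).1 h₂
      have : m' - m = Submodule.inclusion hM ⟨_, τ.2.2 m⟩ := Subtype.ext (by simp [hm'])
      rw [← map_sub, this, hfP]
      exact (P.g₂ _).2
    · intro w v w' h₁ h₂
      obtain ⟨m, rfl, rfl⟩ := (build₂ _ _ _ _).1 h₁
      obtain ⟨m', hm', rfl⟩ := (build₁ _ _ _ _).1 h₂
      obtain rfl := f.2.1 hm'
      exact τ.2.2 _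
  · rintro ⟨f, τ⟩ ⟨f', τ'⟩ h
    have h : build f τ = build f' τ' := congrArg Subtype.val h
    have hf : f = f' := by
      refine Subtype.ext (LinearMap.ext fun m => ?_)
      have := (build₂ f τ _ _).2 ⟨m, rfl, rfl⟩
      rw [h, build₂] at this
      obtain ⟨m', hm, hm'⟩ := this
      rw [← hm', Subtype.ext hm]
    subst hf
    refine Prod.ext rfl (Subtype.ext (LinearMap.ext fun m => ?_))
    have := (build₁ f τ _ _).2 ⟨m, rfl, rfl⟩
    rw [h, build₁] at this
    obtain ⟨m', hm, hm'⟩ := this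
    obtain rfl := f.2.1 hm
    exact Subtype.ext hm'.symm
  · rintro ⟨Q, hQ, rfl⟩
    have hQ' := isTrivialExt_iff.1 hQ
    refine ⟨⟨⟨Q.V.subtype ∘ₗ Q.g₂.toLinearMap, ?_, ?_⟩, ⟨(Q.g₂.trans Q.g₁).toLinearMap, ?_, ?_⟩⟩,
      Subtype.ext (ext_rel (fun v w => ?_) (fun w v => ?_))⟩
    · exact Q.V.injective_subtype.comp Q.g₂.injective
    · ext1 a
      exact (hQ'.1.2 a _ ⟨a.2, rfl⟩).2
    · intro a
      have h₂ := (hQ'.1.2 a _ ⟨a.2, rfl⟩).2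
      have h₁ := (hQ'.1.1 _ _ ⟨(P.g₂ a).2, rfl⟩).2
      have h₃ : Q.g₂ (Submodule.inclusion hM a) = ⟨P.g₂ a, hQ.le_V (P.g₂ a).2⟩ := Subtype.ext h₂
      change (Q.g₁ (Q.g₂ (Submodule.inclusion hM a)) : Fin n → F) = _
      rw [h₃]
      exact h₁
    · intro m
      exact hQ.2.2 m
    · refine (build₁ _ _ _ _).trans ⟨?_, ?_⟩
      · rintro ⟨m, rfl, rfl⟩
        exact ⟨(Q.g₂ m).2, rfl⟩
      · rintro ⟨h, rfl⟩
        exact ⟨Q.g₂.symm ⟨v, h⟩, by simp, by simp⟩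
    · refine (build₂ _ _ _ _).trans ⟨?_, ?_⟩
      · rintro ⟨m, rfl, rfl⟩
        exact ⟨m.2, rfl⟩
      · rintro ⟨h, rfl⟩
        exact ⟨⟨w, h⟩, rfl, rfl⟩

lemma finrank_W (P : PartialIso F n) : Module.finrank F P.W = Module.finrank F P.V :=
  P.g₂.finrank_eq

lemma natCard_trivialExt_V {P : PartialIso F n} {M : Submodule F (Fin n → F)} :
    Nat.card {Q : PartialIso F n // P.IsTrivialExt Q ∧ Q.V = M} =
      Nat.card {Q : PartialIso F n // P.swap.IsTrivialExt Q ∧ Q.W = M} := by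
  exact Nat.card_congr ((⟨swap, swap, fun _ => rfl, fun _ => rfl⟩ :
    PartialIso F n ≃ PartialIso F n).subtypeEquiv fun Q =>
      and_congr isTrivialExt_swap.symm Iff.rfl)

end PartialIso

variable [Fintype F]

lemma card_fiber_mul_card {G H : Type*} [AddCommGroup G] [AddCommGroup H] (f : G →+ H)
    (hf : Function.Surjective f) (h : H) [Finite H] :
    Nat.card {g : G // f g = h} * Nat.card H = Nat.card G := by
  have := Fintype.ofFinite H
  have e (h' : H) : {g : G // f g = h'} ≃ {g : G // f g = h} := by
    let a := (hf (h - h')).choose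
    have ha : f a = h - h' := (hf (h - h')).choose_spec
    exact (Equiv.addRight a).subtypeEquiv fun g => by
      change f g = h' ↔ f (g + a) = h
      rw [map_add, ha, add_sub_left_comm, add_eq_left, sub_eq_zero]
  rw [← Nat.card_congr (Equiv.sigmaFiberEquiv f), Nat.card_congr (Equiv.sigmaCongrRight e),
    Nat.card_congr (Equiv.sigmaEquivProd _ _), Nat.card_prod, mul_comm]

lemma natCard_linearMap (X Y : Type*) [AddCommGroup X] [Module F X] [AddCommGroup Y] [Module F Y]
    [FiniteDimensional F X] [FiniteDimensional F Y] :
    Nat.card (X →ₗ[F] Y) = Fintype.card F ^ (Module.finrank F X * Module.finrank F Y) := by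
  rw [Module.natCard_eq_pow_finrank (K := F), Module.finrank_linearMap, Nat.card_eq_fintype_card]

lemma injNum_eq_prod {k N : ℕ} (h : k ≤ N) :
    injNum F k N = ∏ i ∈ Finset.range k, (Fintype.card F ^ N - Fintype.card F ^ i) := by
  have := card_linearIndependent (K := F) (V := Fin N → F) (k := k) (by simpa using h)
  rw [Module.finrank_fin_fun] at this
  rw [Finset.prod_range, ← this, injNum]
  refine Nat.card_congr (((Pi.basisFun F (Fin k)).constr F).symm.toEquiv.subtypeEquiv fun f => ?_)
  have hf : f = Fintype.linearCombination F (((Pi.basisFun F (Fin k)).constr F).symm f) := by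
    refine (Pi.basisFun F (Fin k)).ext fun i => ?_
    simp [Fintype.linearCombination_apply, Module.Basis.constr, Pi.single_apply]
  rw [linearIndependent_iff_injective_fintypeLinearCombination]
  change _ ↔ Function.Injective (Fintype.linearCombination F
    (((Pi.basisFun F (Fin k)).constr F).symm f))
  rw [← hf]

lemma injNum_pos {k N : ℕ} (h : k ≤ N) : 0 < injNum F k N := by
  have : Finite {f : (Fin k → F) →ₗ[F] (Fin N → F) // Function.Injective f} :=
    have : Finite ((Fin k → F) →ₗ[F] (Fin N → F)) := Module.finite_of_finite F
    inferInstance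
  have : Nonempty {f : (Fin k → F) →ₗ[F] (Fin N → F) // Function.Injective f} :=
    ⟨inclMap F k N, inclMap_injective F h⟩
  exact Nat.card_pos

lemma qPoch_ne_zero_s15 (m : ℕ) : qPoch (Fintype.card F) m ≠ 0 := by
  refine Finset.prod_ne_zero_iff.2 fun i _ => ?_
  have : (1 : ℚ) < Fintype.card F := by exact_mod_cast Fintype.one_lt_card
  exact (sub_pos.2 (pow_lt_one₀ (by positivity) (inv_lt_one_of_one_lt₀ this) (by simp))).ne'

lemma injNum_mul_qPoch {k N : ℕ} (h : k ≤ N) :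
    (injNum F k N : ℚ) * qPoch (Fintype.card F) (N - k) =
      (Fintype.card F : ℚ) ^ (N * k) * qPoch (Fintype.card F) N := by
  have hq : (Fintype.card F : ℚ) ≠ 0 := by exact_mod_cast Fintype.card_ne_zero
  induction k with
  | zero => simp [injNum_eq_prod (F := F) h]
  | succ k ih =>
    have ih := ih (by omega)
    obtain ⟨d, rfl⟩ : ∃ d, N = k + 1 + d := ⟨N - (k + 1), by omega⟩
    have e₁ : k + 1 + d - k = d + 1 := by omega
    have e₂ : k + 1 + d - (k + 1) = d := by omega
    rw [injNum_eq_prod (by omega)] at ih ⊢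
    rw [e₁, qPoch, Finset.prod_range_succ, ← qPoch] at ih
    have hp : (Fintype.card F : ℚ) ^ ((k + 1 + d) * (k + 1)) =
        (Fintype.card F : ℚ) ^ ((k + 1 + d) * k) * (Fintype.card F : ℚ) ^ (k + 1 + d) := by ring
    rw [e₂, Finset.prod_range_succ, Nat.cast_mul,
      Nat.cast_sub (Nat.pow_le_pow_right Fintype.card_pos (by omega)), hp,
      mul_right_comm _ _ (qPoch _ _), mul_right_comm _ _ (qPoch _ _), ← ih]
    push_cast
    rw [inv_pow]
    field_simp
    ring

lemma phi_coeff {k n n' : ℕ} (hk : k ≤ n) (hnn : n ≤ n') :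
    (Fintype.card F : ℚ) ^ ((n' - n) * k) *
        (qPoch (Fintype.card F) n' * qPoch (Fintype.card F) (n - k)) /
          (qPoch (Fintype.card F) (n' - k) * qPoch (Fintype.card F) n) =
      injNum F k n' / injNum F k n := by
  have h₁ := injNum_mul_qPoch (F := F) hk
  have h₂ := injNum_mul_qPoch (F := F) (hk.trans hnn)
  have hn : (injNum F k n : ℚ) ≠ 0 := by exact_mod_cast (injNum_pos hk).ne'
  have hq : (Fintype.card F : ℚ) ≠ 0 := by exact_mod_cast Fintype.card_ne_zero
  rw [div_eq_div_iff (mul_ne_zero (qPoch_ne_zero_s15 _) (qPoch_ne_zero_s15 _)) hn]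
  have e : n' * k = (n' - n) * k + n * k := by
    rw [← add_mul, Nat.sub_add_cancel hnn]
  rw [e, pow_add] at h₂
  linear_combination (Fintype.card F : ℚ) ^ ((n' - n) * k) * qPoch (Fintype.card F) n' * h₁ -
    qPoch (Fintype.card F) n * h₂

lemma natCard_twist_mul {N : ℕ} {A M : Submodule F (Fin N → F)} (hAM : A ≤ M)
    (σ : A →ₗ[F] A) :
    Nat.card {τ : M →ₗ[F] M // (∀ a, (τ (Submodule.inclusion hAM a) : Fin N → F) = σ a) ∧
        ∀ m, (τ m - m : Fin N → F) ∈ A} *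
      Fintype.card F ^ (Module.finrank F A * Module.finrank F A) =
        Fintype.card F ^ (Module.finrank F M * Module.finrank F A) := by
  rw [← natCard_linearMap A A, ← natCard_linearMap M A]
  let φ : (M →ₗ[F] A) →+ (A →ₗ[F] A) :=
    (LinearMap.lcomp F A (Submodule.inclusion hAM)).toAddMonoidHom
  have hφ : Function.Surjective φ := by
    intro g
    obtain ⟨f, hf⟩ := LinearMap.exists_leftInverse_of_injective (Submodule.inclusion hAM)
      (LinearMap.ker_eq_bot.2 (Submodule.inclusion_injective hAM))
    exact ⟨g ∘ₗ f, by
      change (g ∘ₗ f) ∘ₗ Submodule.inclusion hAM = g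
      rw [LinearMap.comp_assoc, hf, LinearMap.comp_id]⟩
  have : Finite (A →ₗ[F] A) := Module.finite_of_finite F
  refine Eq.trans (congrArg (· * _) ?_) (card_fiber_mul_card φ hφ (σ - LinearMap.id))
  refine Nat.card_congr ?_
  refine
    { toFun := fun τ => ⟨(M.subtype ∘ₗ (τ.1 - LinearMap.id)).codRestrict A fun m => τ.2.2 m, ?_⟩
      invFun := fun δ => ⟨LinearMap.id + Submodule.inclusion hAM ∘ₗ δ.1, ?_, ?_⟩
      left_inv := fun τ => ?_
      right_inv := fun δ => ?_ }
  · ext a : 2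
    change (τ.1 (Submodule.inclusion hAM a) : Fin N → F) - (a : Fin N → F) = σ a - a
    rw [τ.2.1 a]
  · intro a
    have := congrArg Subtype.val (LinearMap.congr_fun δ.2 a)
    simp only [φ] at this
    change ((δ.1 (Submodule.inclusion hAM a) : A) : Fin N → F) = σ a - a at this
    simp [this]
  · intro m
    simp
  · ext m : 3
    change (m : Fin N → F) + ((τ.1 m : Fin N → F) - m) = τ.1 m
    abel
  · ext m : 3
    change ((m : Fin N → F) + (δ.1 m : Fin N → F)) - m = δ.1 m
    abel

namespace PartialIso

lemma natCard_trivialExt_W_mul {P : PartialIso F n} {M : Submodule F (Fin n → F)} (hM : P.W ≤ M) :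
    Nat.card {Q : PartialIso F n // P.IsTrivialExt Q ∧ Q.W = M} *
        (injNum F (Module.finrank F P.V) n *
          Fintype.card F ^ (Module.finrank F P.V * Module.finrank F P.V)) =
      injNum F (Module.finrank F M) n *
        Fintype.card F ^ (Module.finrank F M * Module.finrank F P.V) := by
  rw [natCard_trivialExt_W hM, mul_mul_mul_comm, ← P.finrank_W, natCard_twist_mul hM,
    natCard_extension_mul hM]
  exact P.V.injective_subtype.comp P.g₂.injective

/-- The weight of a partial isomorphism of dimension `i` extended to dimension `k`. -/
noncomputable def weight (F : Type*) [Fintype F] (i k : ℕ) : ℂ :=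
  (Fintype.card F : ℂ) ^ (i * i) / (Fintype.card F : ℂ) ^ (k * i)

lemma inv_natCard_trivialExt_W {P : PartialIso F n} {M : Submodule F (Fin n → F)}
    (hM : P.W ≤ M) :
    (Nat.card {Q : PartialIso F n // P.IsTrivialExt Q ∧ Q.W = M} : ℂ)⁻¹ =
      injNum F (Module.finrank F P.V) n * weight F (Module.finrank F P.V) (Module.finrank F M) /
        injNum F (Module.finrank F M) n := by
  have h := congrArg (Nat.cast (R := ℂ)) (natCard_trivialExt_W_mul hM)
  have hq : (Fintype.card F : ℂ) ≠ 0 := by exact_mod_cast Fintype.card_ne_zero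
  have hi (p : Submodule F (Fin n → F)) : (injNum F (Module.finrank F p) n : ℂ) ≠ 0 := by
    have : Module.finrank F p ≤ n := by simpa using p.finrank_le
    exact_mod_cast (injNum_pos this).ne'
  push_cast at h
  have hne : (injNum F (Module.finrank F P.V) n : ℂ) *
    Fintype.card F ^ (Module.finrank F P.V * Module.finrank F P.V) ≠ 0 :=
      mul_ne_zero (hi _) (pow_ne_zero _ hq)
  rw [eq_div_of_mul_eq hne h, weight]
  have := hi P.V
  have := hi M
  field_simp

lemma inv_natCard_trivialExt_V {P : PartialIso F n} {M : Submodule F (Fin n → F)}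
    (hM : P.V ≤ M) :
    (Nat.card {Q : PartialIso F n // P.IsTrivialExt Q ∧ Q.V = M} : ℂ)⁻¹ =
      injNum F (Module.finrank F P.V) n * weight F (Module.finrank F P.V) (Module.finrank F M) /
        injNum F (Module.finrank F M) n := by
  rw [natCard_trivialExt_V, inv_natCard_trivialExt_W (P := P.swap) hM, ← P.finrank_W]
  rfl

end PartialIso

noncomputable instance : Fintype (Submodule F (Fin n → F)) := Fintype.ofFinite _

end Counting

section Algebra

open PartialIso

lemma mem_Zset_iff {x : PIAlg F n} :
    x ∈ Zset F n ↔ ∀ k l P, x (PartialIso.act k l P) = x P := by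
  refine forall_congr' fun k => forall_congr' fun l => ⟨fun h P => ?_, fun h => ?_⟩
  · conv_lhs => rw [← h]
    exact Finsupp.mapDomain_apply (actEquiv k l).injective x P
  · ext P
    obtain ⟨P, rfl⟩ := (actEquiv k l).surjective P
    exact (Finsupp.mapDomain_apply (actEquiv k l).injective x P).trans (h P).symm

/-- `(P, Q, A, B)` describes a contribution of `P` and `Q` to the coefficient of `R` in a product,
with middle subspace `M`. -/
def Contributes (R : PartialIso F n) (M : Submodule F (Fin n → F))
    (t : PartialIso F n × PartialIso F n × PartialIso F n × PartialIso F n) : Prop :=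
  (t.1.IsTrivialExt t.2.2.1 ∧ t.2.2.1.W = M) ∧ (t.2.1.IsTrivialExt t.2.2.2 ∧ t.2.2.2.V = M) ∧
    t.1.W ⊔ t.2.1.V = M ∧ IsComp t.2.2.1 t.2.2.2 R

lemma pairTerm_apply (A B R : PartialIso F n) :
    pairTerm A B R = if IsComp A B R then 1 else 0 := by
  rw [pairTerm, isComp_iff]
  by_cases h : A.W = B.V <;> simp [h, Finsupp.single_apply]

lemma Contributes.finrank_eq {R : PartialIso F n} {M : Submodule F (Fin n → F)} {t}
    (h : Contributes R M t) : Module.finrank F M = Module.finrank F R.V := by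
  rw [← h.1.2, finrank_W, h.2.2.2.V_eq]

lemma contributes_act {R : PartialIso F n} {M M' : Submodule F (Fin n → F)}
    {l : (Fin n → F) ≃ₗ[F] (Fin n → F)} (hl : ∀ v, l v ∈ M ↔ v ∈ M') {P Q A B : PartialIso F n}
    (h : Contributes R M (P, Q, A, B)) :
    Contributes R M' (P.act (LinearEquiv.refl F _) l, Q.act l (LinearEquiv.refl F _),
      A.act (LinearEquiv.refl F _) l, B.act l (LinearEquiv.refl F _)) := by
  have hM : M.comap (l : (Fin n → F) →ₗ[F] (Fin n → F)) = M' := by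
    ext v
    exact hl v
  have ht {P A : PartialIso F n} (k l : (Fin n → F) ≃ₗ[F] (Fin n → F)) (h : P.IsTrivialExt A) :
      (P.act k l).IsTrivialExt (A.act k l) := by
    rw [isTrivialExt_iff] at h ⊢
    simp only [act_R₁, act_R₂, mem_act_V, mem_act_W, map_sub]
    exact ⟨⟨fun _ _ => h.1.1 _ _, fun _ _ => h.1.2 _ _⟩, fun _ _ _ => h.2.1 _ _ _,
      fun _ _ _ => h.2.2 _ _ _⟩
  obtain ⟨⟨h₁, h₂⟩, ⟨h₃, h₄⟩, h₅, h₆, h₇, h₈⟩ := h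
  dsimp only at *
  refine ⟨⟨ht _ _ h₁, ?_⟩, ⟨ht _ _ h₃, ?_⟩, ?_, ?_, ?_, ?_⟩
  · rw [← hM, ← h₂]
    rfl
  · rw [← hM, ← h₄]
    rfl
  · change P.W.comap (l : (Fin n → F) →ₗ[F] (Fin n → F)) ⊔
      Q.V.comap (l : (Fin n → F) →ₗ[F] (Fin n → F)) = M'
    rw [← hM, ← h₅]
    simp only [Submodule.comap_equiv_eq_map_symm, Submodule.map_sup]
  · exact congrArg (Submodule.comap (l : (Fin n → F) →ₗ[F] (Fin n → F))) h₆
  · intro v w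
    rw [h₇, l.surjective.exists]
    simp only [act_R₁, LinearEquiv.refl_apply]
  · intro v w
    rw [h₈, l.surjective.exists]
    simp only [act_R₂, LinearEquiv.refl_apply]

lemma finrank_act_V (k l : (Fin n → F) ≃ₗ[F] (Fin n → F)) (P : PartialIso F n) :
    Module.finrank F (P.act k l).V = Module.finrank F P.V := by
  change Module.finrank F (P.V.comap (k : (Fin n → F) →ₗ[F] (Fin n → F))) = _
  rw [Submodule.comap_equiv_eq_map_symm, LinearEquiv.finrank_map_eq]

lemma exists_linearEquiv_extend_s15 {n' : ℕ} (hnn : n ≤ n') (k : (Fin n → F) ≃ₗ[F] (Fin n → F)) :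
    ∃ k' : (Fin n' → F) ≃ₗ[F] (Fin n' → F), ∀ v, k' (inclMap F n n' v) = inclMap F n n' (k v) :=
  exists_linearEquiv_comp_eq (inclMap F n n') (inclMap F n n' ∘ₗ k.toLinearMap)
    (inclMap_injective F hnn) ((inclMap_injective F hnn).comp k.injective)

lemma push_act {n' : ℕ} {ι : (Fin n → F) →ₗ[F] (Fin n' → F)} (hι : Function.Injective ι)
    {k l : (Fin n → F) ≃ₗ[F] (Fin n → F)} {k' l' : (Fin n' → F) ≃ₗ[F] (Fin n' → F)}
    (hk : ∀ v, k' (ι v) = ι (k.symm v)) (hl : ∀ v, l' (ι v) = ι (l.symm v))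
    (P : PartialIso F n) : (P.act k l).push ι hι = (P.push ι hι).act k'.symm l'.symm := by
  have hk₁ v : ι (k v) = k'.symm (ι v) := by rw [LinearEquiv.eq_symm_apply, hk]; simp
  have hl₁ v : ι (l v) = l'.symm (ι v) := by rw [LinearEquiv.eq_symm_apply, hl]; simp
  refine ext_rel (fun v w => ?_) (fun w v => ?_)
  · rw [push_R₁, act_R₁, push_R₁]
    constructor
    · rintro ⟨v, w, rfl, rfl, h⟩
      exact ⟨k v, l w, hk₁ v, hl₁ w, (act_R₁ k l P).1 h⟩
    · rintro ⟨v', w', hv, hw, h⟩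
      refine ⟨k.symm v', l.symm w', ?_, ?_, (act_R₁ k l P).2 (by simpa using h)⟩
      · rw [← hk, hv, LinearEquiv.apply_symm_apply]
      · rw [← hl, hw, LinearEquiv.apply_symm_apply]
  · rw [push_R₂, act_R₂, push_R₂]
    constructor
    · rintro ⟨w, v, rfl, rfl, h⟩
      exact ⟨l w, k v, hl₁ w, hk₁ v, (act_R₂ k l P).1 h⟩
    · rintro ⟨w', v', hw, hv, h⟩
      refine ⟨l.symm w', k.symm v', ?_, ?_, (act_R₂ k l P).2 (by simpa using h)⟩
      · rw [← hl, hw, LinearEquiv.apply_symm_apply]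
      · rw [← hk, hv, LinearEquiv.apply_symm_apply]

lemma exists_linearEquiv_of_comap_map {n' : ℕ} {ι : (Fin n → F) →ₗ[F] (Fin n' → F)}
    (hι : Function.Injective ι) (k : (Fin n' → F) ≃ₗ[F] (Fin n' → F))
    {p q : Submodule F (Fin n → F)}
    (h : (p.map ι).comap (k : (Fin n' → F) →ₗ[F] (Fin n' → F)) = q.map ι) :
    ∃ k' : (Fin n → F) ≃ₗ[F] (Fin n → F),
      (∀ v, k' v ∈ p ↔ v ∈ q) ∧ ∀ v ∈ q, ι (k' v) = k (ι v) := by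
  have hm : (q.map ι).map (k : (Fin n' → F) →ₗ[F] (Fin n' → F)) = p.map ι := by
    rw [← h, map_comap_equiv]
  let e : q ≃ₗ[F] p := (((Submodule.equivMapOfInjective ι hι q).trans
    (k.submoduleMap (q.map ι))).trans (LinearEquiv.ofEq _ _ hm)).trans
      (Submodule.equivMapOfInjective ι hι p).symm
  have he (v : q) : ι (e v) = k (ι v) :=
    congrArg Subtype.val (LinearEquiv.apply_symm_apply (Submodule.equivMapOfInjective ι hι p)
      (LinearEquiv.ofEq _ _ hm (k.submoduleMap (q.map ι) (Submodule.equivMapOfInjective ι hι q v))))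
  obtain ⟨k', hk'⟩ := Submodule.exists_linearEquiv_restrict_eq e
  refine ⟨k', fun v => ⟨fun hv => ?_, fun hv => ?_⟩, fun v hv => ?_⟩
  · obtain ⟨u, hu⟩ := e.surjective ⟨k' v, hv⟩
    have := hk' u
    rw [hu] at this
    exact k'.injective this ▸ u.2
  · exact hk' ⟨v, hv⟩ ▸ Subtype.prop _
  · rw [← he ⟨v, hv⟩, ← hk' ⟨v, hv⟩]

lemma push_orbit {n' : ℕ} {ι : (Fin n → F) →ₗ[F] (Fin n' → F)} (hι : Function.Injective ι)
    {P Q : PartialIso F n} {k l : (Fin n' → F) ≃ₗ[F] (Fin n' → F)}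
    (h : (P.push ι hι).act k l = Q.push ι hι) : ∃ k' l', P.act k' l' = Q := by
  obtain ⟨k', hk, hk'⟩ := exists_linearEquiv_of_comap_map hι k (congrArg PartialIso.V h)
  obtain ⟨l', hl, hl'⟩ := exists_linearEquiv_of_comap_map hι l (congrArg PartialIso.W h)
  refine ⟨k', l', ext_rel (fun v w => ?_) (fun w v => ?_)⟩
  · by_cases hv : v ∈ Q.V ∧ w ∈ Q.W
    · rw [act_R₁, ← push_R₁_apply hι, hk' v hv.1, hl' w hv.2, ← act_R₁, h, push_R₁_apply]
    · refine iff_of_false (fun h' => hv ?_) fun h' => hv ⟨h'.mem_left, h'.mem_right⟩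
      exact ⟨(hk v).1 h'.mem_left, (hl w).1 h'.mem_right⟩
  · by_cases hv : w ∈ Q.W ∧ v ∈ Q.V
    · rw [act_R₂, ← push_R₂_apply hι, hk' v hv.2, hl' w hv.1, ← act_R₂, h, push_R₂_apply]
    · refine iff_of_false (fun h' => hv ?_) fun h' => hv ⟨h'.mem_left, h'.mem_right⟩
      exact ⟨(hl w).1 h'.mem_left, (hk v).1 h'.mem_right⟩

variable [Fintype F]

lemma phiMap_apply {n' : ℕ} (hnn : n ≤ n') (x : PIAlg F n') (R : PartialIso F n) :
    (injNum F (Module.finrank F R.V) n : ℂ) * phiMap hnn x R =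
      injNum F (Module.finrank F R.V) n' * x (R.push (inclMap F n n') (inclMap_injective F hnn)) := by
  have hk : Module.finrank F R.V ≤ n := by simpa using R.V.finrank_le
  have hn : (injNum F (Module.finrank F R.V) n : ℂ) ≠ 0 := by exact_mod_cast (injNum_pos hk).ne'
  rw [phiMap, Finsupp.sum_fintype _ _ (by simp), Finsupp.finsetSum_apply,
    Finset.sum_eq_single (R.push (inclMap F n n') (inclMap_injective F hnn))]
  · rw [dif_pos (sup_le (push_V_le _ R) (push_W_le _ R)), pull_push, Finsupp.single_eq_same,
      finrank_push_V, phi_coeff hk hnn]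
    push_cast
    field_simp
  · intro P _ hP
    split_ifs with h
    · refine Finsupp.single_eq_of_ne fun hR => hP ?_
      rw [hR, push_pull]
    · rfl
  · simp

lemma avgR_apply (P A : PartialIso F n) (M : Submodule F (Fin n → F)) :
    avgR P M A = if P.IsTrivialExt A ∧ A.W = M then
      (Nat.card {Q : PartialIso F n // P.IsTrivialExt Q ∧ Q.W = M} : ℂ)⁻¹ else 0 := by
  rw [avgR, finsum_eq_sum_of_fintype]
  simp only [finsum_eq_if, Finsupp.smul_apply, Finsupp.finsetSum_apply]
  rw [Finset.sum_eq_single A]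
  · split_ifs <;> simp
  · intro Q _ hQ
    split_ifs
    · exact Finsupp.single_eq_of_ne hQ.symm
    · rfl
  · simp

lemma avgL_apply (P A : PartialIso F n) (M : Submodule F (Fin n → F)) :
    avgL P M A = if P.IsTrivialExt A ∧ A.V = M then
      (Nat.card {Q : PartialIso F n // P.IsTrivialExt Q ∧ Q.V = M} : ℂ)⁻¹ else 0 := by
  rw [avgL, finsum_eq_sum_of_fintype]
  simp only [finsum_eq_if, Finsupp.smul_apply, Finsupp.finsetSum_apply]
  rw [Finset.sum_eq_single A]
  · split_ifs <;> simp
  · intro Q _ hQ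
    split_ifs
    · exact Finsupp.single_eq_of_ne hQ.symm
    · rfl
  · simp

lemma mulBasis_apply (P Q R : PartialIso F n) :
    mulBasis P Q R = ∑ A, ∑ B, avgR P (P.W ⊔ Q.V) A * avgL Q (P.W ⊔ Q.V) B * pairTerm A B R := by
  rw [mulBasis, Finsupp.sum_fintype _ _ (by simp), Finsupp.finsetSum_apply]
  refine Finset.sum_congr rfl fun A _ => ?_
  rw [Finsupp.sum_fintype _ _ (by simp), Finsupp.finsetSum_apply]
  rfl

lemma piMul_apply (x y : PIAlg F n) (R : PartialIso F n) :
    piMul x y R = ∑ P, ∑ Q, x P * y Q * mulBasis P Q R := by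
  rw [piMul, Finsupp.sum_fintype _ _ (by simp), Finsupp.finsetSum_apply]
  refine Finset.sum_congr rfl fun P _ => ?_
  rw [Finsupp.sum_fintype _ _ (by simp), Finsupp.finsetSum_apply]
  rfl

/-- The coefficient of `P` in `x`, renormalized. -/
noncomputable def normCoeff (k : ℕ) (x : PIAlg F n) (P : PartialIso F n) : ℂ :=
  injNum F (Module.finrank F P.V) n * x P * weight F (Module.finrank F P.V) k

/-- The total contribution of the middle subspace `M` to the coefficient of `R` in `x * y`. -/
noncomputable def middleSum (x y : PIAlg F n) (R : PartialIso F n)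
    (M : Submodule F (Fin n → F)) : ℂ :=
  ∑ t, if Contributes R M t then normCoeff (Module.finrank F R.V) x t.1 *
    normCoeff (Module.finrank F R.V) y t.2.1 else 0

lemma piMul_apply_eq_sum (x y : PIAlg F n) (R : PartialIso F n) :
    (injNum F (Module.finrank F R.V) n : ℂ) ^ 2 * piMul x y R = ∑ M, middleSum x y R M := by
  have hn : (injNum F (Module.finrank F R.V) n : ℂ) ≠ 0 := by
    have : Module.finrank F R.V ≤ n := by simpa using R.V.finrank_le
    exact_mod_cast (injNum_pos this).ne'
  simp only [piMul_apply, mulBasis_apply, middleSum, Finset.mul_sum]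
  rw [Finset.sum_comm (s := Finset.univ (α := Submodule F (Fin n → F)))]
  simp only [Fintype.sum_prod_type]
  refine Finset.sum_congr rfl fun P _ => Finset.sum_congr rfl fun Q _ =>
    Finset.sum_congr rfl fun A _ => Finset.sum_congr rfl fun B _ => ?_
  rw [Finset.sum_eq_single (P.W ⊔ Q.V), avgR_apply, avgL_apply, pairTerm_apply]
  · by_cases h : Contributes R (P.W ⊔ Q.V) (P, Q, A, B)
    · have hk := h.finrank_eq
      rw [if_pos h, if_pos h.1, if_pos h.2.1, if_pos h.2.2.2,
        inv_natCard_trivialExt_W le_sup_left, inv_natCard_trivialExt_V le_sup_right, hk,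
        normCoeff, normCoeff]
      field_simp
    · rw [if_neg h]
      have : ¬ ((P.IsTrivialExt A ∧ A.W = P.W ⊔ Q.V) ∧ (Q.IsTrivialExt B ∧ B.V = P.W ⊔ Q.V) ∧
          IsComp A B R) := fun h' => h ⟨h'.1, h'.2.1, rfl, h'.2.2⟩
      split_ifs <;> simp_all
  · intro M _ hM
    exact if_neg fun h => hM h.2.2.1.symm
  · simp

lemma normCoeff_act {k : ℕ} {x : PIAlg F n} (hx : x ∈ Zset F n)
    (a b : (Fin n → F) ≃ₗ[F] (Fin n → F)) (P : PartialIso F n) :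
    normCoeff k x (P.act a b) = normCoeff k x P := by
  rw [normCoeff, finrank_act_V, mem_Zset_iff.1 hx, normCoeff]

lemma middleSum_eq {x y : PIAlg F n} (hx : x ∈ Zset F n) (hy : y ∈ Zset F n)
    (R : PartialIso F n) {M M' : Submodule F (Fin n → F)}
    (h : Module.finrank F M' = Module.finrank F M) :
    middleSum x y R M = middleSum x y R M' := by
  obtain ⟨l, hl⟩ := Submodule.exists_linearEquiv_restrict_eq (LinearEquiv.ofFinrankEq M' M h)
  have hMl : M'.map (l : (Fin n → F) →ₗ[F] (Fin n → F)) = M := by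
    refine Submodule.eq_of_le_of_finrank_eq ?_ ?_
    · rintro _ ⟨v, hv, rfl⟩
      exact hl ⟨v, hv⟩ ▸ Subtype.prop _
    · rw [← h, LinearEquiv.finrank_map_eq]
  have hl' : ∀ v, l v ∈ M ↔ v ∈ M' := fun v => by
    rw [← hMl]
    refine ⟨?_, fun hv => ⟨v, hv, rfl⟩⟩
    rintro ⟨u, hu, huv⟩
    exact l.injective huv ▸ hu
  let e := (actEquiv (LinearEquiv.refl F (Fin n → F)) l).prodCongr
    ((actEquiv l (LinearEquiv.refl F (Fin n → F))).prodCongr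
      ((actEquiv (LinearEquiv.refl F (Fin n → F)) l).prodCongr
        (actEquiv l (LinearEquiv.refl F (Fin n → F)))))
  refine Fintype.sum_equiv e _ _ fun ⟨P, Q, A, B⟩ => ?_
  change _ = if Contributes R M' (P.act (LinearEquiv.refl F _) l, Q.act l (LinearEquiv.refl F _),
      A.act (LinearEquiv.refl F _) l, B.act l (LinearEquiv.refl F _)) then
      normCoeff _ x (P.act _ _) * normCoeff _ y (Q.act _ _) else 0
  rw [normCoeff_act hx, normCoeff_act hy]
  refine if_congr ⟨contributes_act hl', fun h => ?_⟩ rfl rfl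
  have := contributes_act (M := M') (M' := M) (l := l.symm) (fun v => by simp [← hl']) h
  have hr (P : PartialIso F n) :
      (P.act (LinearEquiv.refl F _) l).act (LinearEquiv.refl F _) l.symm = P :=
    act_symm_act (LinearEquiv.refl F _) l P
  have hr' (P : PartialIso F n) :
      (P.act l (LinearEquiv.refl F _)).act l.symm (LinearEquiv.refl F _) = P :=
    act_symm_act l (LinearEquiv.refl F _) P
  rwa [hr, hr, hr', hr'] at this

lemma injNum_mul_piMul {x y : PIAlg F n} (hx : x ∈ Zset F n) (hy : y ∈ Zset F n)
    (R : PartialIso F n) :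
    (injNum F (Module.finrank F R.V) n : ℂ) * piMul x y R =
      middleSum x y R R.V / Nat.card ((Fin (Module.finrank F R.V) → F) ≃ₗ[F]
        (Fin (Module.finrank F R.V) → F)) := by
  have hk : Module.finrank F R.V ≤ n := by simpa using R.V.finrank_le
  have hn : (injNum F (Module.finrank F R.V) n : ℂ) ≠ 0 := by exact_mod_cast (injNum_pos hk).ne'
  have hsum := piMul_apply_eq_sum x y R
  have hM : ∑ M, middleSum x y R M =
      Nat.card {M : Submodule F (Fin n → F) // Module.finrank F M = Module.finrank F R.V} *
        middleSum x y R R.V := by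
    rw [Nat.card_eq_fintype_card, Fintype.card_subtype, ← nsmul_eq_mul, ← Finset.sum_const,
      Finset.sum_filter]
    refine Finset.sum_congr rfl fun M _ => ?_
    split_ifs with h
    · exact middleSum_eq hx hy R h.symm
    · exact Finset.sum_eq_zero fun t _ => if_neg fun ht => h ht.finrank_eq
  have hc := congrArg (Nat.cast (R := ℂ)) (injNum_eq_card_mul (F := F) (Module.finrank F R.V) n)
  push_cast at hc
  rw [hc] at hn
  have h₁ := left_ne_zero_of_mul hn
  have h₂ := right_ne_zero_of_mul hn
  rw [hM, hc] at hsum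
  rw [hc, eq_div_iff h₂]
  refine mul_left_cancel₀ h₁ ?_
  rw [← hsum]
  ring

lemma middleSum_push {n' : ℕ} (hnn : n ≤ n') (x y : PIAlg F n') (R : PartialIso F n) :
    middleSum x y (R.push (inclMap F n n') (inclMap_injective F hnn))
        (R.push (inclMap F n n') (inclMap_injective F hnn)).V =
      middleSum (phiMap hnn x) (phiMap hnn y) R R.V := by
  let ι := inclMap F n n'
  have hι := inclMap_injective F hnn
  let p : PartialIso F n → PartialIso F n' := push ι hι
  have hp : Function.Injective p := push_injective hι
  let e : PartialIso F n × PartialIso F n × PartialIso F n × PartialIso F n →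
    PartialIso F n' × PartialIso F n' × PartialIso F n' × PartialIso F n' :=
    Prod.map p (Prod.map p (Prod.map p p))
  have he : Function.Injective e := hp.prodMap (hp.prodMap (hp.prodMap hp))
  have hsurj {P : PartialIso F n'} (hV : P.V ≤ LinearMap.range ι) (hW : P.W ≤ LinearMap.range ι) :
      ∃ P', p P' = P := ⟨_, push_pull hι P hV hW⟩
  have hmap (M : Submodule F (Fin n → F)) : M.map ι ≤ LinearMap.range ι := LinearMap.map_le_range
  refine (Fintype.sum_of_injective e he _ _ ?_ ?_).symm
  · rintro ⟨P, Q, A, B⟩ ht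
    refine if_neg fun h => ht ?_
    have hA₁ : A.V ≤ LinearMap.range ι := h.2.2.2.V_eq.trans_le (hmap _)
    have hA₂ : A.W ≤ LinearMap.range ι := h.1.2.trans_le (hmap _)
    have hB₁ : B.V ≤ LinearMap.range ι := h.2.1.2.trans_le (hmap _)
    have hB₂ : B.W ≤ LinearMap.range ι := h.2.2.2.W_eq.trans_le (hmap _)
    obtain ⟨A, rfl⟩ := hsurj hA₁ hA₂
    obtain ⟨B, rfl⟩ := hsurj hB₁ hB₂
    obtain ⟨P, rfl⟩ := hsurj (h.1.1.le_V.trans hA₁) (h.1.1.le_W.trans hA₂)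
    obtain ⟨Q, rfl⟩ := hsurj (h.2.1.1.le_V.trans hB₁) (h.2.1.1.le_W.trans hB₂)
    exact ⟨(P, Q, A, B), rfl⟩
  · rintro ⟨P, Q, A, B⟩
    have hinj := Submodule.map_injective_of_injective hι
    have hc : Contributes (p R) (p R).V (p P, p Q, p A, p B) ↔
        Contributes R R.V (P, Q, A, B) := by
      refine and_congr (and_congr (push_isTrivialExt hι) ?_)
        (and_congr (and_congr (push_isTrivialExt hι) ?_) (and_congr ?_ (push_isComp hι)))
      · exact hinj.eq_iff
      · exact hinj.eq_iff
      · change P.W.map ι ⊔ Q.V.map ι = R.V.map ι ↔ _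
        rw [← Submodule.map_sup]
        exact hinj.eq_iff
    have hx (k : ℕ) (x : PIAlg F n') (P : PartialIso F n) :
        normCoeff k (phiMap hnn x) P = normCoeff k x (p P) := by
      rw [normCoeff, phiMap_apply, normCoeff, finrank_push_V]
    dsimp only [e, Prod.map]
    rw [hx, hx, finrank_push_V]
    exact if_congr hc.symm rfl rfl

lemma phiMap_mem_Zset {n' : ℕ} (hnn : n ≤ n') {x : PIAlg F n'} (hx : x ∈ Zset F n') :
    phiMap hnn x ∈ Zset F n := by
  refine mem_Zset_iff.2 fun k l P => ?_
  obtain ⟨k', hk⟩ := exists_linearEquiv_extend_s15 hnn k.symm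
  obtain ⟨l', hl⟩ := exists_linearEquiv_extend_s15 hnn l.symm
  have hP := push_act (inclMap_injective F hnn) hk hl P
  have h := phiMap_apply hnn x (P.act k l)
  have hn : (injNum F (Module.finrank F P.V) n : ℂ) ≠ 0 := by
    have : Module.finrank F P.V ≤ n := by simpa using P.V.finrank_le
    exact_mod_cast (injNum_pos this).ne'
  rw [hP, mem_Zset_iff.1 hx, finrank_act_V, ← phiMap_apply hnn] at h
  exact mul_left_cancel₀ hn h

lemma exists_phiMap_eq {n' : ℕ} (hnn : n ≤ n') {y : PIAlg F n} (hy : y ∈ Zset F n) :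
    ∃ x ∈ Zset F n', phiMap hnn x = y := by
  have hι := inclMap_injective F hnn
  let S (P' : PartialIso F n') (c : ℂ) : Prop := ∃ (P : PartialIso F n) (k l : _),
    P'.act k l = P.push _ hι ∧
      c = injNum F (Module.finrank F P.V) n * y P / injNum F (Module.finrank F P.V) n'
  have hS {P' c c'} (h : S P' c) (h' : S P' c') : c = c' := by
    obtain ⟨P, k, l, hP, rfl⟩ := h
    obtain ⟨Q, k', l', hQ, rfl⟩ := h'
    obtain ⟨a, b, rfl⟩ : ∃ a b, P.act a b = Q := by
      refine push_orbit hι (k := k'.trans k.symm) (l := l'.trans l.symm) ?_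
      rw [← hP, ← hQ]
      exact ext_rel (fun v w => by simp [act_R₁]) (fun w v => by simp [act_R₂])
    rw [finrank_act_V, mem_Zset_iff.1 hy]
  have hSact {P' c} (k l : (Fin n' → F) ≃ₗ[F] (Fin n' → F)) : S (P'.act k l) c ↔ S P' c := by
    constructor
    · rintro ⟨P, a, b, hP, hc⟩
      refine ⟨P, a.trans k, b.trans l, ?_, hc⟩
      rw [← hP]
      exact ext_rel (fun v w => by simp [act_R₁]) (fun w v => by simp [act_R₂])
    · rintro ⟨P, a, b, hP, hc⟩
      refine ⟨P, a.trans k.symm, b.trans l.symm, ?_, hc⟩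
      rw [← hP]
      exact ext_rel (fun v w => by simp [act_R₁]) (fun w v => by simp [act_R₂])
  refine ⟨Finsupp.equivFunOnFinite.symm fun P' => if h : ∃ c, S P' c then h.choose else 0,
    mem_Zset_iff.2 fun k l P' => ?_, ?_⟩
  · have h : S (P'.act k l) = S P' := funext fun c => propext (hSact k l)
    rw [Finsupp.equivFunOnFinite_symm_apply_apply, Finsupp.equivFunOnFinite_symm_apply_apply, h]
  · ext P
    have hk : Module.finrank F P.V ≤ n := by simpa using P.V.finrank_le
    have hn : (injNum F (Module.finrank F P.V) n : ℂ) ≠ 0 := by exact_mod_cast (injNum_pos hk).ne'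
    have hn' : (injNum F (Module.finrank F P.V) n' : ℂ) ≠ 0 := by
      exact_mod_cast (injNum_pos (hk.trans hnn)).ne'
    have hP : S (P.push _ hι) (injNum F (Module.finrank F P.V) n * y P /
        injNum F (Module.finrank F P.V) n') :=
      ⟨P, LinearEquiv.refl F _, LinearEquiv.refl F _,
        ext_rel (fun v w => by simp [act_R₁]) (fun w v => by simp [act_R₂]), rfl⟩
    have hex : ∃ c, S (P.push _ hι) c := ⟨_, hP⟩
    refine mul_left_cancel₀ hn ?_
    rw [phiMap_apply, Finsupp.equivFunOnFinite_symm_apply_apply, dif_pos hex,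
      hS hex.choose_spec hP]
    field_simp

lemma phiMap_piMul {n' : ℕ} (hnn : n ≤ n') {x y : PIAlg F n'} (hx : x ∈ Zset F n')
    (hy : y ∈ Zset F n') : phiMap hnn (piMul x y) = piMul (phiMap hnn x) (phiMap hnn y) := by
  ext R
  have hk : Module.finrank F R.V ≤ n := by simpa using R.V.finrank_le
  have hn : (injNum F (Module.finrank F R.V) n : ℂ) ≠ 0 := by exact_mod_cast (injNum_pos hk).ne'
  refine mul_left_cancel₀ hn ?_
  have h := injNum_mul_piMul hx hy (R.push _ (inclMap_injective F hnn))
  rw [middleSum_push, finrank_push_V] at h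
  rw [phiMap_apply, h, injNum_mul_piMul (phiMap_mem_Zset hnn hx) (phiMap_mem_Zset hnn hy)]

lemma phiMap_single_unit {n' : ℕ} (hnn : n ≤ n') :
    phiMap hnn (Finsupp.single (PartialIso.unit F n') (1 : ℂ)) =
      Finsupp.single (PartialIso.unit F n) (1 : ℂ) := by
  have hι := inclMap_injective F hnn
  have hu : (PartialIso.unit F n).push _ hι = PartialIso.unit F n' := by
    have hR (m : ℕ) (v w) : (PartialIso.unit F m).R₁ v w ↔ v = 0 ∧ w = 0 := by
      constructor
      · exact fun h => ⟨h.mem_left, h.mem_right⟩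
      · rintro ⟨rfl, rfl⟩
        exact ⟨Submodule.zero_mem _, rfl⟩
    have h (v w) : ((PartialIso.unit F n).push _ hι).R₁ v w ↔ (PartialIso.unit F n').R₁ v w := by
      simp only [push_R₁, hR]
      constructor
      · rintro ⟨_, _, rfl, rfl, rfl, rfl⟩
        exact ⟨map_zero _, map_zero _⟩
      · rintro ⟨rfl, rfl⟩
        exact ⟨0, 0, map_zero _, map_zero _, rfl, rfl⟩
    exact ext_rel h h
  ext R
  have hk : Module.finrank F R.V ≤ n := by simpa using R.V.finrank_le
  have hn : (injNum F (Module.finrank F R.V) n : ℂ) ≠ 0 := by exact_mod_cast (injNum_pos hk).ne'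
  refine mul_left_cancel₀ hn ?_
  rw [phiMap_apply, ← hu]
  by_cases hR : R = PartialIso.unit F n
  · subst hR
    have h0 : Module.finrank F (PartialIso.unit F n).V = 0 := finrank_bot F (Fin n → F)
    have h1 (m : ℕ) : injNum F 0 m = 1 := by
      simp [injNum_eq_prod]
    simp [h0, h1]
  · rw [Finsupp.single_eq_of_ne hR, Finsupp.single_eq_of_ne ((push_injective hι).ne hR), mul_zero,
      mul_zero]

end Algebra

/-- The maps `φ_n^{n'}` send `𝒵(n',F)` onto `𝒵(n,F)`, and their restrictions to the
invariant subalgebras are unital algebra homomorphisms. -/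
theorem statement15 (F : Type*) [Field F] [Fintype F] (n n' : ℕ) (hnn : n ≤ n') :
    (phiMap (F := F) hnn) '' (Zset F n') = Zset F n ∧
    (∀ x ∈ Zset F n', ∀ y ∈ Zset F n',
      phiMap hnn (piMul x y) = piMul (phiMap hnn x) (phiMap hnn y)) ∧
    phiMap hnn (Finsupp.single (PartialIso.unit F n') (1 : ℂ)) =
      Finsupp.single (PartialIso.unit F n) (1 : ℂ) := by
  refine ⟨Set.Subset.antisymm ?_ fun y hy => exists_phiMap_eq hnn hy,
    fun x hx y hy => phiMap_piMul hnn hx hy, phiMap_single_unit hnn⟩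
  rintro _ ⟨x, hx, rfl⟩
  exact phiMap_mem_Zset hnn hx
end
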